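/- Let p be a prime with p ≥ 5 and k an even integer, and let K = Q(√-1). If f ∈ M_k^{(s)}(U_2(O_K), ν_k)_Q (all Fourier coefficients rational) satisfies a_f([[m, α],[ᾱ, n]]) ∈ Z_(p) for all integers m, n and all α ∈ D_K^{-1} with 0 ≤ m ≤ (5k+8)/40, 0 ≤ n ≤ (15k+4)/120 and mn − N(α) ≥ 0, then all Fourier coefficients of f lie in Z_(p), i.e. f ∈ M_k^{(s)}(U_2(O_K), ν_k)_{Z_(p)}. -/

import Mathlib

open Complex Matrix
open scoped ComplexOrder

noncomputable section

/-- `√d_K` for an imaginary quadratic discriminant `d < 0`,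
taken as `√|d| · i` in the upper half plane. -/
def sqrtD (d : ℤ) : ℂ := Real.sqrt (-d) * Complex.I

/-- The ring of integers `O_K = ℤ[(d + √d)/2]` of the imaginary quadratic field of
discriminant `d`, viewed as a subset of `ℂ`. -/
def ringInt (d : ℤ) : Set ℂ :=
  {z | ∃ a b : ℤ, z = (a : ℂ) + (b : ℂ) * (((d : ℂ) + sqrtD d) / 2)}

/-- The inverse different `D_K⁻¹ = O_K / √d_K`. -/
def invDiff (d : ℤ) : Set ℂ := {z | sqrtD d * z ∈ ringInt d}

/-- The Hermitian upper half-space of degree 2: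
`Z` with `(Z - ᵗZ̄)/(2i)` positive definite. -/
def HermitianUpperHalfSpace : Set (Matrix (Fin 2) (Fin 2) ℂ) :=
  {Z | ((Z - Zᴴ).map (fun w => w / (2 * Complex.I))).PosDef}

/-- The lattice `Λ₂(K)`: Hermitian matrices with integral diagonal and
`√d_K ·`(off-diagonal entries) in `O_K`. -/
def LambdaH (d : ℤ) : Set (Matrix (Fin 2) (Fin 2) ℂ) :=
  {H | H.IsHermitian ∧ (∀ i, ∃ n : ℤ, H i i = (n : ℂ)) ∧
    ∀ i j, sqrtD d * H i j ∈ ringInt d}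

/-- Semi-positive elements of `Λ₂(K)`, the index set of Fourier expansions. -/
def HermLattice (d : ℤ) : Set (Matrix (Fin 2) (Fin 2) ℂ) :=
  {H | H ∈ LambdaH d ∧ H.PosSemidef}

/-- The symplectic-form matrix `J₂ = [[0, -1], [1, 0]]` (2×2 blocks). -/
def J2 : Matrix (Fin 2 ⊕ Fin 2) (Fin 2 ⊕ Fin 2) ℂ :=
  Matrix.fromBlocks 0 (-1) 1 0

/-- The Hermitian modular group `U₂(O_K)`:
matrices with entries in `O_K` satisfying `ᵗM̄ J₂ M = J₂`. -/
def HermitianModularGroup (d : ℤ) : Set (Matrix (Fin 2 ⊕ Fin 2) (Fin 2 ⊕ Fin 2) ℂ) :=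
  {M | (∀ i j, M i j ∈ ringInt d) ∧ Mᴴ * J2 * M = J2}

/-- The fractional-linear action `Z ↦ (AZ + B)(CZ + D)⁻¹`. -/
def matAct (M : Matrix (Fin 2 ⊕ Fin 2) (Fin 2 ⊕ Fin 2) ℂ)
    (Z : Matrix (Fin 2) (Fin 2) ℂ) : Matrix (Fin 2) (Fin 2) ℂ :=
  (M.toBlocks₁₁ * Z + M.toBlocks₁₂) * (M.toBlocks₂₁ * Z + M.toBlocks₂₂)⁻¹

/-- The character `ν_k`: `det^{k/2}` for `K = ℚ(√-1)` (i.e. `d = -4`, `k` even),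
and `det^k` for `K = ℚ(√-3)` (i.e. `d = -3`). -/
def nuChar (d k : ℤ) (M : Matrix (Fin 2 ⊕ Fin 2) (Fin 2 ⊕ Fin 2) ℂ) : ℂ :=
  if d = -4 then M.det ^ (k / 2) else M.det ^ k

/-- A Hermitian modular form of degree 2, weight `k` and character `ν_k` for `U₂(O_K)`,
bundled with its Fourier expansion over the semi-positive part of `Λ₂(K)`. -/
structure HermitianModularForm (d k : ℤ) where
  toFun : Matrix (Fin 2) (Fin 2) ℂ → ℂ
  coeff : Matrix (Fin 2) (Fin 2) ℂ → ℂ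
  holo : DifferentiableOn ℂ (fun Z : Fin 2 → Fin 2 → ℂ => toFun (Matrix.of Z))
    {Z | Matrix.of Z ∈ HermitianUpperHalfSpace}
  transform : ∀ M ∈ HermitianModularGroup d, ∀ Z ∈ HermitianUpperHalfSpace,
    toFun (matAct M Z) =
      nuChar d k M * (M.toBlocks₂₁ * Z + M.toBlocks₂₂).det ^ k * toFun Z
  coeff_supported : ∀ H, coeff H ≠ 0 → H ∈ HermLattice d
  expansion : ∀ Z ∈ HermitianUpperHalfSpace,
    HasSum (fun H : HermLattice d =>
      coeff H * Complex.exp (2 * Real.pi * Complex.I * ((H : Matrix (Fin 2) (Fin 2) ℂ) * Z).trace))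
      (toFun Z)

/-- A Hermitian modular form is symmetric if `f(ᵗZ) = f(Z)`. -/
def IsSymmetricHMF {d k : ℤ} (f : HermitianModularForm d k) : Prop :=
  ∀ Z ∈ HermitianUpperHalfSpace, f.toFun Zᵀ = f.toFun Z

/-- `z` is a `p`-integral rational number: `z = a/b` with `p ∤ b`. -/
def IsPIntegral (p : ℕ) (z : ℂ) : Prop :=
  ∃ a b : ℤ, ¬ (p : ℤ) ∣ b ∧ (b : ℂ) * z = (a : ℂ)

/-- `z ≡ w (mod p^l)` in the local ring `ℤ_(p)`, i.e. `(z - w)/p^l` is `p`-integral. -/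
def ModCongr (p l : ℕ) (z w : ℂ) : Prop :=
  IsPIntegral p ((z - w) / (p : ℂ) ^ l)


/-- The lexicographic order on `Λ₂(K)` used to define `ord_p`:
compare first `tr H`, then the `(1,1)`-entry `m`, then (for off-diagonal entry
`(a + b i)/2`) first `a`, then `b`. -/
def lexLt (H H' : Matrix (Fin 2) (Fin 2) ℂ) : Prop :=
  H.trace.re < H'.trace.re ∨
    (H.trace = H'.trace ∧
      ((H 0 0).re < (H' 0 0).re ∨
        (H 0 0 = H' 0 0 ∧
          ((H 0 1).re < (H' 0 1).re ∨
            ((H 0 1).re = (H' 0 1).re ∧ (H 0 1).im < (H' 0 1).im)))))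

/-- The Siegel upper half-space of degree `n`: symmetric complex matrices with
positive definite imaginary part. -/
def SiegelUpperHalfSpace (n : ℕ) : Set (Matrix (Fin n) (Fin n) ℂ) :=
  {Z | Z.IsSymm ∧ ((Z - Zᴴ).map (fun w => w / (2 * Complex.I))).PosDef}

/-- The symplectic-form matrix over `ℤ` in degree `n`. -/
def Jn (n : ℕ) : Matrix (Fin n ⊕ Fin n) (Fin n ⊕ Fin n) ℤ :=
  Matrix.fromBlocks 0 (-1) 1 0

/-- The Siegel modular group `Γ_n = Sp_n(ℤ)` (as a set of `2n × 2n` integer matrices). -/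
def SiegelModularGroup (n : ℕ) : Set (Matrix (Fin n ⊕ Fin n) (Fin n ⊕ Fin n) ℤ) :=
  {M | Mᵀ * Jn n * M = Jn n}

/-- The fractional-linear action of an integral symplectic matrix on the Siegel
upper half-space. -/
def matActS {n : ℕ} (M : Matrix (Fin n ⊕ Fin n) (Fin n ⊕ Fin n) ℤ)
    (Z : Matrix (Fin n) (Fin n) ℂ) : Matrix (Fin n) (Fin n) ℂ :=
  ((M.map (fun a => (a : ℂ))).toBlocks₁₁ * Z + (M.map (fun a => (a : ℂ))).toBlocks₁₂) *
    ((M.map (fun a => (a : ℂ))).toBlocks₂₁ * Z + (M.map (fun a => (a : ℂ))).toBlocks₂₂)⁻¹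

/-- The index lattice of Fourier expansions of Siegel modular forms of level `N`:
semi-positive symmetric rational matrices `T` with `N·T` half-integral,
i.e. `T ∈ (1/N)Λ_n`. -/
def SiegelLattice (n : ℕ) (N : ℕ) : Set (Matrix (Fin n) (Fin n) ℚ) :=
  {T | T.IsSymm ∧ (∀ i, ∃ a : ℤ, (N : ℚ) * T i i = (a : ℚ)) ∧
    (∀ i j, ∃ a : ℤ, 2 * (N : ℚ) * T i j = (a : ℚ)) ∧
    (T.map (fun q => (q : ℝ))).PosSemidef}

/-- A Siegel modular form of degree `n` and weight `k` for a subgroup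
`Γ ⊆ Γ_n = Sp_n(ℤ)` of level `N`, bundled with its Fourier expansion. For the
full modular group take `Γ = SiegelModularGroup n` and `N = 1`. -/
structure SiegelModularForm (n : ℕ) (k : ℤ)
    (Γ : Set (Matrix (Fin n ⊕ Fin n) (Fin n ⊕ Fin n) ℤ)) (N : ℕ) where
  toFun : Matrix (Fin n) (Fin n) ℂ → ℂ
  coeff : Matrix (Fin n) (Fin n) ℚ → ℂ
  holo : DifferentiableOn ℂ (fun Z : Fin n → Fin n → ℂ => toFun (Matrix.of Z))
    {Z | Matrix.of Z ∈ SiegelUpperHalfSpace n}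
  transform : ∀ M ∈ Γ, ∀ Z ∈ SiegelUpperHalfSpace n,
    toFun (matActS M Z) =
      ((M.map (fun a => (a : ℂ))).toBlocks₂₁ * Z +
        (M.map (fun a => (a : ℂ))).toBlocks₂₂).det ^ k * toFun Z
  coeff_supported : ∀ T, coeff T ≠ 0 → T ∈ SiegelLattice n N
  expansion : ∀ Z ∈ SiegelUpperHalfSpace n,
    HasSum (fun T : SiegelLattice n N =>
      coeff T * Complex.exp (2 * Real.pi * Complex.I *
        (((T : Matrix (Fin n) (Fin n) ℚ).map (fun q => (q : ℂ))) * Z).trace))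
      (toFun Z)


/-- A Hermitian cusp form (degree 2, class number one field): the Fourier
coefficients vanish off the positive definite part of the lattice. -/
def IsCuspHMF {d k : ℤ} (f : HermitianModularForm d k) : Prop :=
  ∀ H, ¬ H.PosDef → f.coeff H = 0

/-- `H0 = ord_p f`: `H0` is the minimal element of `Λ₂(K)`, in the lexicographic
order `lexLt`, whose Fourier coefficient is not divisible by `p`. -/
def IsOrdP (p : ℕ) {d k : ℤ} (f : HermitianModularForm d k)
    (H0 : Matrix (Fin 2) (Fin 2) ℂ) : Prop :=
  H0 ∈ HermLattice d ∧ ¬ ModCongr p 1 (f.coeff H0) 0 ∧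
    ∀ H ∈ HermLattice d, lexLt H H0 → ModCongr p 1 (f.coeff H) 0

section CoefficientRings

open PowerSeries

/-- Power series whose coefficients with index in the lower set `D` lie in the subring `A`. -/
def coeffsIn (A : Subring ℂ) (D : LowerSet ℕ) : Subring (PowerSeries ℂ) where
  carrier := {F | ∀ n ∈ D, coeff n F ∈ A}
  mul_mem' {F G} hF hG n hn := by
    rw [coeff_mul]
    refine A.sum_mem fun ij hij => ?_
    have h := Finset.HasAntidiagonal.mem_antidiagonal.1 hij
    exact A.mul_mem (hF _ (D.lower (by omega) hn)) (hG _ (D.lower (by omega) hn))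
  one_mem' n _ := by
    rw [coeff_one]; split_ifs
    exacts [A.one_mem, A.zero_mem]
  add_mem' hF hG n hn := by
    rw [map_add]; exact A.add_mem (hF n hn) (hG n hn)
  zero_mem' n _ := by rw [map_zero]; exact A.zero_mem
  neg_mem' hF n hn := by rw [map_neg]; exact A.neg_mem (hF n hn)

variable {A : Subring ℂ} {D : LowerSet ℕ}

lemma mem_coeffsIn {F : PowerSeries ℂ} : F ∈ coeffsIn A D ↔ ∀ n ∈ D, coeff n F ∈ A := Iff.rfl

lemma coeffsIn_mono {D' : LowerSet ℕ} (h : D' ≤ D) : coeffsIn A D ≤ coeffsIn A D' :=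
  fun _ hF n hn => hF n (h hn)

lemma mem_coeffsIn_top {F : PowerSeries ℂ} : F ∈ coeffsIn A ⊤ ↔ ∀ n, coeff n F ∈ A :=
  ⟨fun h n => h n trivial, fun h n _ => h n⟩

lemma C_mem_coeffsIn {a : ℂ} (ha : a ∈ A) : C a ∈ coeffsIn A D := fun n _ => by
  rw [coeff_C]; split_ifs
  exacts [ha, A.zero_mem]

/-- Dividing by a series `q + O(q ^ 2)` over `A` keeps the coefficients in `A`. -/
lemma coeff_mem_of_mul_of_coeff_one {F G : PowerSeries ℂ} (hF : F ∈ coeffsIn A ⊤)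
    (hF0 : coeff 0 F = 0) (hF1 : coeff 1 F = 1) {n : ℕ}
    (h : ∀ i ≤ n + 1, coeff i (F * G) ∈ A) : coeff n G ∈ A := by
  induction n using Nat.strong_induction_on with | _ n ih =>
  have key := h (n + 1) le_rfl
  rw [coeff_mul, Finset.Nat.sum_antidiagonal_succ, hF0, zero_mul, zero_add] at key
  cases n with
  | zero => simpa [hF1] using key
  | succ n =>
    rw [Finset.Nat.sum_antidiagonal_succ] at key
    simp only [zero_add, hF1, one_mul] at key
    refine (A.add_mem_cancel_right (A.sum_mem fun ij hij => ?_)).1 key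
    have hij := Finset.HasAntidiagonal.mem_antidiagonal.1 hij
    exact A.mul_mem (mem_coeffsIn_top.1 hF _)
      (ih _ (by omega) fun i hi => h i (by omega))

end CoefficientRings

section LevelOne

open UpperHalfPlane ModularForm ModularFormClass MatrixGroups EisensteinSeries

variable {A : Subring ℂ}

lemma qExpansion_E₄_mem : qExpansion 1 E₄ ∈ coeffsIn A ⊤ := fun n _ => by
  rw [E_qExpansion_coeff _ ⟨2, rfl⟩, show bernoulli 4 = -1 / 30 by decide +kernel]
  split_ifs
  · exact A.one_mem
  · have : -(2 * ((4 : ℕ) : ℂ) / ((-1 / 30 : ℚ) : ℂ)) = ((240 : ℕ) : ℂ) := by push_cast; norm_num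
    rw [this]
    exact A.mul_mem (natCast_mem A _) (natCast_mem A _)

lemma qExpansion_E₆_mem : qExpansion 1 E₆ ∈ coeffsIn A ⊤ := fun n _ => by
  rw [E_qExpansion_coeff _ ⟨3, rfl⟩, show bernoulli 6 = 1 / 42 by decide +kernel]
  split_ifs
  · exact A.one_mem
  · have : -(2 * ((6 : ℕ) : ℂ) / ((1 / 42 : ℚ) : ℂ)) = ((-504 : ℤ) : ℂ) := by push_cast; norm_num
    rw [this]
    exact A.mul_mem (intCast_mem A _) (natCast_mem A _)

lemma qExpansion_discriminant_mem (hA : (12 : ℂ)⁻¹ ∈ A) :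
    qExpansion 1 discriminant ∈ coeffsIn A ⊤ := by
  let e₄ : ModularForm 𝒮ℒ 12 := (E₄.pow 3).mcast (by norm_num)
  let e₆ : ModularForm 𝒮ℒ 12 := (E₆.pow 2).mcast (by norm_num)
  have h : (discriminant : ℍ → ℂ) = ((12 : ℂ)⁻¹ ^ 3) • ⇑(e₄ - e₆) := by
    funext z
    rw [discriminant_eq_E₄_cube_sub_E₆_sq]
    change _ = (12 : ℂ)⁻¹ ^ 3 * ((E₄.pow 3) z - (E₆.pow 2) z)
    rw [ModularForm.coe_pow, ModularForm.coe_pow, Pi.pow_apply, Pi.pow_apply]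
    ring
  rw [h, ModularForm.qExpansion_smul one_pos one_mem_strictPeriods_SL, FunLike.coe_sub,
    ModularForm.qExpansion_sub one_pos one_mem_strictPeriods_SL,
    show (e₄ : ℍ → ℂ) = E₄.pow 3 from rfl, show (e₆ : ℍ → ℂ) = E₆.pow 2 from rfl,
    ModularForm.qExpansion_pow one_pos one_mem_strictPeriods_SL,
    ModularForm.qExpansion_pow one_pos one_mem_strictPeriods_SL,
    PowerSeries.smul_eq_C_mul]
  exact Subring.mul_mem _ (C_mem_coeffsIn (A.pow_mem hA 3))
    (Subring.sub_mem _ (Subring.pow_mem _ qExpansion_E₄_mem 3)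
      (Subring.pow_mem _ qExpansion_E₆_mem 2))

/-- A level one form whose coefficients up to the Sturm bound lie in a subring containing `1/12`
has all its coefficients in that subring. -/
lemma ModularForm.qExpansion_mem_of_sturm (hA : (12 : ℂ)⁻¹ ∈ A) (w : ℤ) (f : ModularForm 𝒮ℒ w)
    (h : ∀ n : ℕ, 12 * (n : ℤ) ≤ w → (qExpansion 1 f).coeff n ∈ A) :
    qExpansion 1 f ∈ coeffsIn A ⊤ := by
  obtain ⟨N, hN⟩ : ∃ N : ℕ, w < N := ⟨w.toNat + 1, by omega⟩
  induction N using Nat.strong_induction_on generalizing w with | _ N ih =>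
  have hzero : f = 0 → qExpansion 1 f ∈ coeffsIn A ⊤ := by
    rintro rfl
    rw [FunLike.coe_zero, qExpansion_zero]
    exact Subring.zero_mem _
  rcases lt_or_ge w 0 with hw | hw
  · exact hzero (rank_zero_iff_forall_zero.mp (levelOne_neg_weight_rank_zero hw) f)
  rcases Int.even_or_odd w with hev | hodd
  swap
  · exact hzero (levelOne_odd_weight_eq_zero hodd f)
  have hcases : w = 2 ∨ ∃ a b : ℕ, (a : ℤ) * 4 + b * 6 = w := by
    obtain ⟨t, rfl⟩ := hev
    rcases Int.even_or_odd t with ⟨s, rfl⟩ | ⟨s, rfl⟩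
    · exact Or.inr ⟨s.toNat, 0, by omega⟩
    · rcases eq_or_ne s 0 with rfl | hs
      · exact Or.inl rfl
      · exact Or.inr ⟨(s - 1).toNat, 1, by omega⟩
  rcases hcases with rfl | ⟨a, b, hab⟩
  · exact hzero (rank_zero_iff_forall_zero.mp levelOne_weight_two_rank_zero f)
  set h0 := (qExpansion 1 f).coeff 0 with hh0
  let e : ModularForm 𝒮ℒ w := ((E₄.pow a).mul (E₆.pow b)).mcast hab
  have he : qExpansion 1 e = qExpansion 1 E₄ ^ a * qExpansion 1 E₆ ^ b := by
    rw [show (e : ℍ → ℂ) = (E₄.pow a).mul (E₆.pow b) from rfl,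
      ModularForm.qExpansion_mul one_pos one_mem_strictPeriods_SL,
      ModularForm.qExpansion_pow one_pos one_mem_strictPeriods_SL,
      ModularForm.qExpansion_pow one_pos one_mem_strictPeriods_SL]
  have hemem : qExpansion 1 e ∈ coeffsIn A ⊤ := by
    rw [he]
    exact Subring.mul_mem _ (Subring.pow_mem _ qExpansion_E₄_mem _)
      (Subring.pow_mem _ qExpansion_E₆_mem _)
  have he0 : (qExpansion 1 e).coeff 0 = 1 := by
    have h4 := E_qExpansion_coeff_zero (k := 4) (by norm_num) ⟨2, rfl⟩
    have h6 := E_qExpansion_coeff_zero (k := 6) (by norm_num) ⟨3, rfl⟩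
    rw [PowerSeries.coeff_zero_eq_constantCoeff_apply] at h4 h6 ⊢
    rw [he, map_mul, map_pow, map_pow, h4, h6, one_pow, one_pow, one_mul]
  have h0A : h0 ∈ A := h 0 (by simpa using hw)
  have hse : qExpansion 1 (h0 • e) = PowerSeries.C h0 * qExpansion 1 e := by
    rw [ModularForm.qExpansion_smul one_pos one_mem_strictPeriods_SL,
      PowerSeries.smul_eq_C_mul]
  have hsemem : qExpansion 1 (h0 • e) ∈ coeffsIn A ⊤ := by
    rw [hse]; exact Subring.mul_mem _ (C_mem_coeffsIn h0A) hemem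
  let g := f - h0 • e
  have hg : qExpansion 1 g = qExpansion 1 f - qExpansion 1 (h0 • e) := by
    rw [FunLike.coe_sub, ModularForm.qExpansion_sub one_pos one_mem_strictPeriods_SL,
      FunLike.coe_smul]
  have hg0 : (qExpansion 1 g).coeff 0 = 0 := by
    rw [hg, hse, map_sub, PowerSeries.coeff_C_mul, he0, mul_one, sub_self]
  suffices hgmem : qExpansion 1 g ∈ coeffsIn A ⊤ by
    rw [hg] at hgmem
    simpa using Subring.add_mem _ hgmem hsemem
  rw [qExpansion_eq_qExpansion_discriminant_mul g hg0]
  refine Subring.mul_mem _ (qExpansion_discriminant_mem hA) ?_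
  refine ih (N - 1) (by omega) (w - 12) _ (fun n hn => ?_) (by omega)
  refine coeff_mem_of_mul_of_coeff_one (qExpansion_discriminant_mem hA)
    (CuspFormClass.qExpansion_coeff_zero CuspForm.discriminant one_pos one_mem_strictPeriods_SL)
    discriminant_qExpansion_coeff_one (fun i hi => ?_)
  rw [← qExpansion_eq_qExpansion_discriminant_mul g hg0, hg, map_sub]
  exact A.sub_mem (h i (by omega)) (hsemem i trivial)

end LevelOne

section ConvergentSeries

open PowerSeries

lemma hasFPowerSeriesOnBall_ofScalars {c : ℕ → ℂ} {f : ℂ → ℂ}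
    (h : ∀ q : ℂ, ‖q‖ < 1 → HasSum (fun n => c n * q ^ n) (f q)) :
    HasFPowerSeriesOnBall f (.ofScalars ℂ c) 0 1 := by
  refine ⟨?_, one_pos, fun {y} hy => ?_⟩
  · refine le_of_forall_lt_imp_le_of_dense fun r hr => ?_
    lift r to NNReal using hr.ne_top
    apply FormalMultilinearSeries.le_radius_of_summable
    have hr1 : ‖((r : ℝ) : ℂ)‖ < 1 := by simpa using hr
    refine (h _ hr1).summable.norm.congr fun n => ?_
    rw [FormalMultilinearSeries.ofScalars_norm, norm_mul, norm_pow]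
    simp
  · have hy1 : ‖y‖ < 1 := by
      rwa [← ENNReal.ofReal_one, Metric.eball_ofReal, mem_ball_zero_iff] at hy
    simpa [FormalMultilinearSeries.ofScalars_apply_eq, mul_comm] using h y hy1

lemma eq_of_hasSum_pow {c d : ℕ → ℂ} {f : ℂ → ℂ}
    (hc : ∀ q : ℂ, ‖q‖ < 1 → HasSum (fun n => c n * q ^ n) (f q))
    (hd : ∀ q : ℂ, ‖q‖ < 1 → HasSum (fun n => d n * q ^ n) (f q)) : c = d := by
  have := (hasFPowerSeriesOnBall_ofScalars hc).hasFPowerSeriesAt.eq_formalMultilinearSeries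
    (hasFPowerSeriesOnBall_ofScalars hd).hasFPowerSeriesAt
  funext n
  simpa [FormalMultilinearSeries.coeff_ofScalars] using
    congrArg (fun p => FormalMultilinearSeries.coeff p n) this

lemma summable_coeff_mul {F G : PowerSeries ℂ} {q : ℂ}
    (hF : Summable fun n => coeff n F * q ^ n) (hG : Summable fun n => coeff n G * q ^ n) :
    Summable (fun n => coeff n (F * G) * q ^ n) ∧
      ∑' n, coeff n (F * G) * q ^ n = (∑' n, coeff n F * q ^ n) * ∑' n, coeff n G * q ^ n := by
  have key : (fun n => ∑ kl ∈ Finset.HasAntidiagonal.antidiagonal n,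
      coeff kl.1 F * q ^ kl.1 * (coeff kl.2 G * q ^ kl.2)) =
      fun n => coeff n (F * G) * q ^ n := by
    funext n
    rw [coeff_mul, Finset.sum_mul]
    refine Finset.sum_congr rfl fun ij hij => ?_
    rw [← Finset.HasAntidiagonal.mem_antidiagonal.1 hij, pow_add]
    ring
  constructor
  · rw [← key]
    exact (summable_norm_sum_mul_antidiagonal_of_summable_norm hF.norm hG.norm).of_norm
  · rw [← key]
    exact (tsum_mul_tsum_eq_tsum_sum_antidiagonal_of_summable_norm hF.norm hG.norm).symm

/-- Power series converging on the open unit disc. -/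
def convDisc : Subring (PowerSeries ℂ) where
  carrier := {F | ∀ q : ℂ, ‖q‖ < 1 → Summable fun n => coeff n F * q ^ n}
  mul_mem' hF hG q hq := (summable_coeff_mul (hF q hq) (hG q hq)).1
  one_mem' q _ := summable_of_ne_finset_zero (s := {0}) fun n hn => by
    rw [coeff_one, if_neg (by simpa using hn), zero_mul]
  add_mem' hF hG q hq := by simpa [add_mul] using (hF q hq).add (hG q hq)
  zero_mem' q _ := by simp
  neg_mem' hF q hq := by simpa using (hF q hq).neg

/-- Evaluation of a convergent power series at a point of the open unit disc. -/
def evalDisc (q : ℂ) (hq : ‖q‖ < 1) : convDisc →+* ℂ where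
  toFun F := ∑' n, coeff n F.1 * q ^ n
  map_one' := by
    rw [tsum_eq_single 0 fun n hn => by simp [coeff_one, hn]]
    simp
  map_mul' F G := (summable_coeff_mul (F.2 q hq) (G.2 q hq)).2
  map_zero' := by simp
  map_add' F G := by
    simpa [add_mul] using (F.2 q hq).tsum_add (G.2 q hq)

lemma hasSum_evalDisc (F : convDisc) (q : ℂ) (hq : ‖q‖ < 1) :
    HasSum (fun n => coeff n F.1 * q ^ n) (evalDisc q hq F) := (F.2 q hq).hasSum

lemma evalDisc_zero (F : convDisc) : evalDisc 0 (by simp) F = coeff 0 F.1 := by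
  have h := hasSum_single (f := fun n => coeff n F.1 * (0 : ℂ) ^ n) 0 fun n hn => by simp [hn]
  rw [pow_zero, mul_one] at h
  exact (hasSum_evalDisc F 0 (by simp)).unique h

lemma hasFPowerSeriesOnBall_convDisc (F : convDisc) :
    HasFPowerSeriesOnBall (fun q => ∑' n, coeff n F.1 * q ^ n)
      (.ofScalars ℂ fun n => coeff n F.1) 0 1 :=
  hasFPowerSeriesOnBall_ofScalars fun q hq => (F.2 q hq).hasSum

lemma differentiableOn_convDisc (F : convDisc) :
    DifferentiableOn ℂ (fun q => ∑' n, coeff n F.1 * q ^ n) (Metric.ball 0 1) := by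
  have := (hasFPowerSeriesOnBall_convDisc F).differentiableOn
  rwa [← ENNReal.ofReal_one, Metric.eball_ofReal] at this

lemma convDisc_ext {F G : convDisc} (h : ∀ q hq, evalDisc q hq F = evalDisc q hq G) : F = G := by
  ext n
  exact congrFun (eq_of_hasSum_pow (f := fun q => ∑' n, coeff n F.1 * q ^ n)
    (fun q hq => hasSum_evalDisc F q hq)
    (fun q hq => by simpa [← h q hq] using! hasSum_evalDisc G q hq)) n

/-- A holomorphic function on the unit disc comes from a convergent power series. -/
lemma exists_convDisc_of_differentiableOn {g : ℂ → ℂ}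
    (hg : DifferentiableOn ℂ g (Metric.ball 0 1)) :
    ∃ G : convDisc, ∀ q hq, evalDisc q hq G = g q := by
  have key : ∀ q : ℂ, ‖q‖ < 1 → HasSum (fun n : ℕ =>
      coeff n (PowerSeries.mk fun n => (n.factorial : ℂ)⁻¹ * iteratedDeriv n g 0) * q ^ n)
      (g q) := fun q hq => by
    have := Complex.hasSum_taylorSeries_on_ball (r := 1) (by simpa using hg)
      (z := q) (by simpa using hq)
    convert! this using 2 with n
    simp
    ring
  exact ⟨⟨_, fun q hq => (key q hq).summable⟩, fun q hq => (key q hq).tsum_eq⟩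

lemma isUnit_convDisc (F : convDisc) (hF : ∀ q hq, evalDisc q hq F ≠ 0) : IsUnit F := by
  obtain ⟨G, hG⟩ := exists_convDisc_of_differentiableOn (g := fun q =>
    (∑' n, coeff n F.1 * q ^ n)⁻¹)
    ((differentiableOn_convDisc F).inv fun q hq => hF q (by simpa using hq))
  refine IsUnit.of_mul_eq_one G (convDisc_ext fun q hq => ?_)
  rw [map_mul, map_one, hG]
  exact mul_inv_cancel₀ (hF q hq)

lemma coeff_mem_of_mul_of_constantCoeff_one {A : Subring ℂ} {D : LowerSet ℕ}
    {F G : PowerSeries ℂ} (hF : F ∈ coeffsIn A D)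
    (hF0 : coeff 0 F = 1) (h : F * G ∈ coeffsIn A D) : G ∈ coeffsIn A D := by
  intro n
  induction n using Nat.strong_induction_on with | _ n ih =>
  intro hn
  have key := h n hn
  cases n with
  | zero => simpa [coeff_mul, hF0] using key
  | succ n =>
    rw [coeff_mul, Finset.Nat.sum_antidiagonal_succ] at key
    simp only [hF0, one_mul] at key
    refine (A.add_mem_cancel_right (A.sum_mem fun ij hij => ?_)).1 key
    have hij := Finset.HasAntidiagonal.mem_antidiagonal.1 hij
    exact A.mul_mem (hF _ (D.lower (by omega) hn))
      (ih _ (by omega) (D.lower (by omega) hn))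

end ConvergentSeries

section ModularSeries

open UpperHalfPlane ModularForm ModularFormClass MatrixGroups EisensteinSeries
open scoped Manifold Real

/-- The nome `exp (2πiτ)`. -/
def nome (τ : ℍ) : ℂ := Function.Periodic.qParam 1 τ

lemma norm_nome_lt_one (τ : ℍ) : ‖nome τ‖ < 1 :=
  Function.Periodic.norm_qParam_lt_one one_pos τ.im_pos

lemma nome_eq (τ : ℍ) : nome τ = cexp (2 * π * Complex.I * τ) := by
  simp [nome, Function.Periodic.qParam]

/-- Evaluation of a convergent power series at the nome of a point of the upper half plane. -/
def evalQ (τ : ℍ) : convDisc →+* ℂ := evalDisc (nome τ) (norm_nome_lt_one τ)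

lemma hasSum_evalQ (F : convDisc) (τ : ℍ) :
    HasSum (fun n => PowerSeries.coeff n F.1 * nome τ ^ n) (evalQ τ F) := hasSum_evalDisc F _ _

lemma exists_nome_eq {q : ℂ} (hq : ‖q‖ < 1) (h0 : q ≠ 0) : ∃ τ : ℍ, nome τ = q :=
  ⟨⟨Function.Periodic.invQParam 1 q,
    Function.Periodic.im_invQParam_pos_of_norm_lt_one one_pos hq h0⟩,
    Function.Periodic.qParam_right_inv one_ne_zero h0⟩

/-- A convergent power series, viewed as a function of `τ`, transforming with weight `w`
under `τ ↦ -1/τ`. -/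
def IsModularSeries (w : ℤ) (F : convDisc) : Prop :=
  ∀ τ : ℍ, evalQ (ModularGroup.S • τ) F = (τ : ℂ) ^ w * evalQ τ F

lemma mdifferentiable_evalQ (F : convDisc) : MDiff (fun τ : ℍ => evalQ τ F) := by
  rw [UpperHalfPlane.mdifferentiable_iff]
  have h1 : DifferentiableOn ℂ
      ((fun q => ∑' n, PowerSeries.coeff n F.1 * q ^ n) ∘ fun z : ℂ => cexp (2 * π * Complex.I * z))
      {z | 0 < z.im} := by
    refine (differentiableOn_convDisc F).comp (by fun_prop) fun z hz => ?_
    simpa [nome_eq] using norm_nome_lt_one ⟨z, hz⟩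
  refine h1.congr fun z hz => ?_
  simp only [Function.comp_apply, evalQ, evalDisc, RingHom.coe_mk, MonoidHom.coe_mk, OneHom.coe_mk,
    nome_eq, ofComplex_apply_of_im_pos hz]

/-- The level one modular form attached to a convergent power series. -/
def modularFormOfSeries {w : ℤ} {F : convDisc} (hF : IsModularSeries w F) :
    ModularForm 𝒮ℒ w :=
  have hslash : ∀ γ : SL(2, ℤ), (fun τ : ℍ => evalQ τ F) ∣[w] γ = fun τ : ℍ => evalQ τ F := by
    refine SlashInvariantForm.slash_action_generators_SL2Z ?_ ?_
    · funext τ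
      rw [SlashInvariantForm.slash_S_apply, ← modular_S_smul, hF τ, _root_.zpow_neg, mul_comm,
        ← mul_assoc,
        inv_mul_cancel₀ (zpow_ne_zero _ τ.ne_zero), one_mul]
    · funext τ
      rw [SL_slash_apply]
      have hn : nome (ModularGroup.T • τ) = nome τ := by
        rw [nome_eq, nome_eq, modular_T_smul, coe_vadd, ofReal_one, mul_add, exp_add]
        simp
      have hd : denom ModularGroup.T τ = 1 := by
        rw [ModularGroup.denom_apply]; simp [ModularGroup.T]
      rw [hd, _root_.one_zpow, mul_one]
      simp only [evalQ, hn]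
  { toFun := fun τ => evalQ τ F
    slash_action_eq' := fun _ ⟨γ, hγ⟩ => hγ ▸ hslash γ
    holo' := mdifferentiable_evalQ F
    bdd_at_cusps' := fun {c} hc => by
      rw [Subgroup.IsArithmetic.isCusp_iff_isCusp_SL2Z] at hc
      rw [OnePoint.isBoundedAt_iff_forall_SL2Z hc]
      intro γ _
      rw [hslash γ]
      exact isBoundedAtImInfty_of_hasSum_qExpansion one_pos fun τ => hasSum_evalQ F τ }

lemma modularFormOfSeries_apply {w : ℤ} {F : convDisc} (hF : IsModularSeries w F) (τ : ℍ) :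
    modularFormOfSeries hF τ = evalQ τ F := rfl

lemma qExpansion_modularFormOfSeries {w : ℤ} {F : convDisc} (hF : IsModularSeries w F) :
    qExpansion 1 (modularFormOfSeries hF) = F.1 := by
  ext n
  exact (ModularFormClass.qExpansion_coeff_unique one_pos one_mem_strictPeriods_SL
    (f := modularFormOfSeries hF) (fun τ => hasSum_evalQ F τ) n).symm

/-- Sturm bound with coefficients: a convergent series which is modular of weight `w` has all its
coefficients in `A` as soon as those of index at most `w / 12` lie in `A`. -/
lemma IsModularSeries.mem_coeffsIn {A : Subring ℂ} (hA : (12 : ℂ)⁻¹ ∈ A) {w : ℤ} {F : convDisc}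
    (hF : IsModularSeries w F)
    (h : ∀ n : ℕ, 12 * (n : ℤ) ≤ w → PowerSeries.coeff n F.1 ∈ A) : F.1 ∈ coeffsIn A ⊤ := by
  rw [← qExpansion_modularFormOfSeries hF] at h ⊢
  exact ModularForm.qExpansion_mem_of_sturm hA w _ h

/-- A nonzero series of weight `12` with vanishing constant coefficient has no zero on the upper
half plane. -/
lemma IsModularSeries.evalQ_ne_zero_of_weight_twelve {F : convDisc} (hF : IsModularSeries 12 F)
    (h0 : PowerSeries.coeff 0 F.1 = 0) (hne : F ≠ 0) (τ : ℍ) : evalQ τ F ≠ 0 := by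
  rw [← qExpansion_modularFormOfSeries hF] at h0
  obtain ⟨c, hc⟩ := CuspForm.exists_smul_discriminant_of_weight_eq_twelve
    (toCuspForm (modularFormOfSeries hF) h0)
  have key : ∀ σ : ℍ, evalQ σ F = c * discriminant σ := fun σ =>
    (DFunLike.congr_fun hc σ).symm
  have hc0 : c ≠ 0 := by
    rintro rfl
    refine hne (Subtype.ext ?_)
    rw [← qExpansion_modularFormOfSeries hF,
      show (modularFormOfSeries hF : ℍ → ℂ) = 0 from funext fun σ => by
        rw [modularFormOfSeries_apply, key, zero_mul, Pi.zero_apply], qExpansion_zero]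
    rfl
  rw [key]
  exact mul_ne_zero hc0 (discriminant_ne_zero τ)

end ModularSeries

section CoshPolynomial

open Polynomial

/-- The polynomial `c` with `2 cosh (r x) = c (2 cosh x - 2)`. -/
def coshPoly (r : ℤ) : ℤ[X] := (Chebyshev.C ℤ r).comp (X + 2)

lemma coshPoly_zero : coshPoly 0 = 2 := by simp [coshPoly]

lemma coshPoly_one : coshPoly 1 = X + 2 := by simp [coshPoly]

lemma coshPoly_add_two (r : ℤ) :
    coshPoly (r + 2) = (X + 2) * coshPoly (r + 1) - coshPoly r := by
  simp [coshPoly, Chebyshev.C_add_two]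

lemma coshPoly_neg (r : ℤ) : coshPoly (-r) = coshPoly r := by simp [coshPoly]

lemma coeff_coshPoly_add_two (r : ℤ) (l : ℕ) :
    (coshPoly (r + 2)).coeff l = 2 * (coshPoly (r + 1)).coeff l +
      (if l = 0 then 0 else (coshPoly (r + 1)).coeff (l - 1)) - (coshPoly r).coeff l := by
  rw [coshPoly_add_two, add_mul, coeff_sub, coeff_add]
  have : (2 * coshPoly (r + 1)).coeff l = 2 * (coshPoly (r + 1)).coeff l := coeff_ofNat_mul
  rw [this]
  cases l with
  | zero => simp
  | succ l => simp [coeff_X_mul]; ring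

lemma coeff_coshPoly_eq_zero (r : ℤ) : ∀ l : ℕ, r.natAbs < l → (coshPoly r).coeff l = 0 := by
  induction r using Chebyshev.induct' with
  | zero =>
    intro l hl
    rw [coshPoly_zero]
    exact coeff_C_of_ne_zero (a := (2 : ℤ)) (by simp at hl; omega)
  | one =>
    intro l hl
    have h0 : (2 : ℤ[X]).coeff l = 0 := coeff_C_of_ne_zero (a := (2 : ℤ)) (by simp at hl; omega)
    rw [coshPoly_one, coeff_add, h0, coeff_X, if_neg (by simp at hl; omega), add_zero]
  | add_two n h1 h0 =>
    intro l hl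
    rw [coeff_coshPoly_add_two, h1 _ (by omega), h0 _ (by omega), if_neg (by omega),
      h1 _ (by omega)]
    simp
  | neg n h => simpa [coshPoly_neg] using h

lemma coeff_coshPoly_natAbs (r : ℤ) : r ≠ 0 → (coshPoly r).coeff r.natAbs = 1 := by
  induction r using Chebyshev.induct' with
  | zero => exact fun h => (h rfl).elim
  | one =>
    intro _
    rw [coshPoly_one, coeff_add]
    simp
  | add_two n h1 h0 =>
    intro _
    have e : ((n : ℤ) + 1).natAbs = n + 1 := by omega
    rw [show ((n : ℤ) + 2).natAbs = n + 2 by omega, coeff_coshPoly_add_two,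
      coeff_coshPoly_eq_zero _ _ (by omega), coeff_coshPoly_eq_zero (n : ℤ) _ (by omega),
      if_neg (by omega), show n + 2 - 1 = n + 1 by omega]
    rw [e] at h1
    rw [h1 (by omega)]
    simp
  | neg n h => simpa [coshPoly_neg] using h

lemma abs_coeff_coshPoly_le (r : ℤ) : ∀ l : ℕ, |(coshPoly r).coeff l| ≤ 2 * 4 ^ r.natAbs := by
  induction r using Chebyshev.induct' with
  | zero =>
    intro l
    rw [coshPoly_zero, show (2 : ℤ[X]) = C 2 from rfl, coeff_C]
    split_ifs <;> simp
  | one =>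
    intro l
    rw [coshPoly_one, show (2 : ℤ[X]) = C 2 from rfl, coeff_add, coeff_C, coeff_X]
    split_ifs <;> norm_num
  | add_two n h1 h0 =>
    intro l
    rw [coeff_coshPoly_add_two, show ((n : ℤ) + 2).natAbs = n + 2 by omega]
    have e1 : ((n : ℤ) + 1).natAbs = n + 1 := by omega
    have e0 : (n : ℤ).natAbs = n := by omega
    rw [e1] at h1
    rw [e0] at h0
    have a1 := abs_le.1 (h1 l)
    have a0 := abs_le.1 (h0 l)
    have a2 : |if l = 0 then 0 else (coshPoly ((n : ℤ) + 1)).coeff (l - 1)| ≤ 2 * 4 ^ (n + 1) := by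
      split_ifs
      · simp
      · exact h1 _
    have a2 := abs_le.1 a2
    have hp : (0 : ℤ) < 4 ^ n := by positivity
    rw [pow_succ] at a1 a2
    rw [show (4 : ℤ) ^ (n + 2) = 4 ^ n * 16 by ring, abs_le]
    constructor <;> linarith [a1.1, a1.2, a0.1, a0.2, a2.1, a2.2]
  | neg n h => simpa [coshPoly_neg] using h

/-- The numbers `t_l(r)` with `cosh (r x) = ∑ l, t_l(r) (2 cosh x - 2) ^ l`. -/
def tcoef (l : ℕ) (r : ℤ) : ℂ := (coshPoly r).coeff l / 2

lemma tcoef_mem {A : Subring ℂ} (hA : (2 : ℂ)⁻¹ ∈ A) (l : ℕ) (r : ℤ) : tcoef l r ∈ A :=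
  A.mul_mem (intCast_mem A _) hA

lemma tcoef_neg (l : ℕ) (r : ℤ) : tcoef l (-r) = tcoef l r := by rw [tcoef, coshPoly_neg, tcoef]

lemma tcoef_eq_zero {l : ℕ} {r : ℤ} (h : r.natAbs < l) : tcoef l r = 0 := by
  rw [tcoef, coeff_coshPoly_eq_zero r l h]; simp

lemma tcoef_natAbs {r : ℤ} (h : r ≠ 0) : tcoef r.natAbs r = 1 / 2 := by
  rw [tcoef, coeff_coshPoly_natAbs r h]; simp

lemma tcoef_zero_zero : tcoef 0 0 = 1 := by
  rw [tcoef, coshPoly_zero, show (2 : ℤ[X]) = C 2 from rfl, coeff_C]; simp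

lemma tcoef_zero_one : tcoef 0 1 = 1 := by
  rw [tcoef, coshPoly_one, show (2 : ℤ[X]) = C 2 from rfl, coeff_add, coeff_C]; simp

lemma norm_tcoef_le (l : ℕ) (r : ℤ) : ‖tcoef l r‖ ≤ Real.exp (2 * |(r : ℝ)|) := by
  have h1 : ‖tcoef l r‖ ≤ 4 ^ r.natAbs := by
    have := abs_coeff_coshPoly_le r l
    have h2 : |((coshPoly r).coeff l : ℝ)| ≤ 2 * 4 ^ r.natAbs := by exact_mod_cast this
    rw [tcoef, norm_div, Complex.norm_intCast]
    norm_num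
    linarith
  refine h1.trans ?_
  have h3 : (4 : ℝ) ≤ Real.exp 2 := by
    have := Real.add_one_le_exp (1 : ℝ)
    rw [show (2 : ℝ) = 1 + 1 by norm_num, Real.exp_add]
    nlinarith
  have h4 : |(r : ℝ)| = (r.natAbs : ℝ) := by
    rw [Nat.cast_natAbs]; simp
  rw [h4, mul_comm, Real.exp_nat_mul]
  gcongr

end CoshPolynomial

section Jets

open PowerSeries

/-- `G` is the expansion of the even entire function `g` in powers of the square of the
variable. -/
def HasJet (g : ℂ → ℂ) (G : PowerSeries ℂ) : Prop :=
  ∀ x : ℂ, HasSum (fun i => coeff i G * (x ^ 2) ^ i) (g x)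

namespace HasJet

variable {g h : ℂ → ℂ} {G H : PowerSeries ℂ}

lemma add (hg : HasJet g G) (hh : HasJet h H) : HasJet (fun x => g x + h x) (G + H) := fun x => by
  simpa [add_mul] using (hg x).add (hh x)

lemma const_mul (hg : HasJet g G) (c : ℂ) : HasJet (fun x => c * g x) (C c * G) := fun x => by
  simpa [mul_assoc] using (hg x).mul_left c

lemma mul (hg : HasJet g G) (hh : HasJet h H) : HasJet (fun x => g x * h x) (G * H) := fun x => by
  have := summable_coeff_mul (hg x).summable (hh x).summable
  rw [(hg x).tsum_eq, (hh x).tsum_eq] at this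
  simpa only [this.2] using this.1.hasSum

lemma sum {ι : Type*} (s : Finset ι) {g : ι → ℂ → ℂ} {G : ι → PowerSeries ℂ}
    (hg : ∀ i ∈ s, HasJet (g i) (G i)) :
    HasJet (fun x => ∑ i ∈ s, g i x) (∑ i ∈ s, G i) := fun x => by
  simpa [Finset.sum_mul] using hasSum_sum fun i hi => hg i hi x

lemma unique (hg : HasJet g G) (hh : HasJet g H) : G = H := by
  have key (F : PowerSeries ℂ) (hF : HasJet g F) (q : ℂ) (_ : ‖q‖ < 1) :
      HasSum (fun n => coeff n F * q ^ n) (g (q ^ ((2 : ℕ)⁻¹ : ℂ))) := by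
    have := hF (q ^ ((2 : ℕ)⁻¹ : ℂ))
    rwa [cpow_nat_inv_pow q two_ne_zero] at this
  ext n
  exact congrFun (eq_of_hasSum_pow (key G hg) (key H hh)) n

lemma comp_mul_left (hg : HasJet g G) (c : ℂ) :
    HasJet (fun x => g (c * x)) (rescale (c ^ 2) G) := fun x => by
  convert! hg (c * x) using 2 with n
  rw [coeff_rescale, mul_pow, mul_pow (c ^ 2)]
  ring

lemma polynomial_eval (hg : HasJet g G) (p : Polynomial ℂ) :
    HasJet (fun x => p.eval (g x)) (Polynomial.aeval G p) := by
  induction p using Polynomial.induction_on with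
  | C a =>
    intro x
    have : (fun i => coeff i (Polynomial.aeval G (Polynomial.C a)) * (x ^ 2) ^ i) =
        fun i => if i = 0 then a else 0 := by
      funext i
      rw [Polynomial.aeval_C, PowerSeries.algebraMap_apply, coeff_C]
      split_ifs with h <;> simp [h]
    simpa only [this, Polynomial.eval_C] using hasSum_ite_eq 0 a
  | add p q hp hq => simpa using hp.add hq
  | monomial n a hn =>
    have := hn.mul hg
    simpa [pow_succ, mul_assoc] using! this

end HasJet

lemma hasJet_cosh (r : ℂ) :
    HasJet (fun x => cosh (r * x)) (mk fun a => r ^ (2 * a) / (2 * a).factorial) := fun x => by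
  convert! Complex.hasSum_cosh (r * x) using 2 with n
  rw [coeff_mk, mul_pow, pow_mul x]
  ring

lemma hasJet_exp (μ : ℂ) :
    HasJet (fun x => cexp (μ * x ^ 2)) (rescale μ (PowerSeries.exp ℂ)) := fun x => by
  rw [Complex.exp_eq_exp_ℂ]
  convert! NormedSpace.expSeries_div_hasSum_exp (μ * x ^ 2) using 2 with n
  rw [coeff_rescale, coeff_exp, mul_pow]
  simp
  ring

/-- The transformation law of jets corresponding to the theta transformation law of functions. -/
lemma HasJet.rescale_eq {g h : ℂ → ℂ} {G H : PowerSeries ℂ} (hg : HasJet g G) (hh : HasJet h H)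
    {t c μ : ℂ} (e : ∀ x, h (t * x) = c * (cexp (μ * x ^ 2) * g x)) :
    rescale (t ^ 2) H = C c * (rescale μ (PowerSeries.exp ℂ) * G) := by
  have h1 := hh.comp_mul_left t
  simp only [e] at h1
  exact h1.unique (((hasJet_exp μ).mul hg).const_mul c)

/-- The expansion of `2 cosh x - 2` in powers of `x ^ 2`. -/
def coshJet : PowerSeries ℂ := mk fun a => if a = 0 then 0 else 2 / ((2 * a).factorial : ℂ)

lemma hasJet_coshJet : HasJet (fun x => 2 * cosh x - 2) coshJet := by
  intro x
  have h1 := ((Complex.hasSum_cosh x).mul_left 2).sub (hasSum_ite_eq 0 (2 : ℂ))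
  convert! h1 using 2 with n
  rw [coshJet, coeff_mk, pow_mul]
  split_ifs with h
  · simp [h]
  · ring

lemma coeff_zero_coshJet : coeff 0 coshJet = 0 := by simp [coshJet]

lemma coeff_one_coshJet : coeff 1 coshJet = 1 := by simp [coshJet]

lemma coeff_two_coshJet : coeff 2 coshJet = 12⁻¹ := by
  norm_num [coshJet, Nat.factorial]

lemma hasSubst_coshJet : HasSubst coshJet :=
  HasSubst.of_constantCoeff_zero' (by simpa using coeff_zero_coshJet)

/-- The substitution of `2 cosh x - 2` into a power series. -/
def substCosh : PowerSeries ℂ →ₐ[ℂ] PowerSeries ℂ := substAlgHom hasSubst_coshJet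

lemma coeff_coshJet_pow_eq_zero {a l : ℕ} (h : a < l) : coeff a (coshJet ^ l) = 0 :=
  coeff_of_lt_order _ (lt_of_lt_of_le (by exact_mod_cast h)
    (le_order_pow_of_constantCoeff_eq_zero l (by simpa using coeff_zero_coshJet)))

lemma coeff_coshJet_pow_self (l : ℕ) : coeff l (coshJet ^ l) = 1 := by
  obtain ⟨F, hF⟩ := X_dvd_iff.2 (show constantCoeff coshJet = 0 by simpa using coeff_zero_coshJet)
  have h1 : constantCoeff F = 1 := by
    have := coeff_one_coshJet
    rwa [hF, show (1 : ℕ) = 0 + 1 from rfl, coeff_succ_X_mul, coeff_zero_eq_constantCoeff] at this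
  have := coeff_X_pow_mul (F ^ l) l 0
  rw [zero_add] at this
  rw [hF, mul_pow, this]
  simp [h1]

lemma coeff_substCosh (F : PowerSeries ℂ) {a m : ℕ} (h : a ≤ m) :
    coeff a (substCosh F) = ∑ l ∈ Finset.range (m + 1), coeff a (coshJet ^ l) * coeff l F := by
  rw [substCosh, coe_substAlgHom, coeff_subst' hasSubst_coshJet,
    finsum_eq_sum_of_support_subset (s := Finset.range (m + 1))]
  · simp [mul_comm]
  · intro l hl
    by_contra hlm
    refine hl ?_
    have : a < l := by simp at hlm; omega
    simp [coeff_coshJet_pow_eq_zero this]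

lemma jet_cosh_eq (r : ℤ) : (mk fun a => (r : ℂ) ^ (2 * a) / (2 * a).factorial) =
    substCosh (mk fun l => tcoef l r) := by
  have hp : (mk fun l => tcoef l r) =
      ((Polynomial.C (1 / 2 : ℂ) * (coshPoly r).map (Int.castRingHom ℂ) : Polynomial ℂ) :
        PowerSeries ℂ) := by
    ext l
    rw [coeff_mk, Polynomial.coeff_coe, Polynomial.coeff_C_mul, Polynomial.coeff_map, tcoef]
    simp
    ring
  rw [hp, substCosh, substAlgHom_coe]
  refine (hasJet_cosh r).unique ?_
  convert! hasJet_coshJet.polynomial_eval _ using 2 with x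
  have h1 : ((coshPoly r).map (Int.castRingHom ℂ)).eval (2 * cosh x - 2) = 2 * cosh (r * x) := by
    rw [coshPoly, Polynomial.map_comp, Polynomial.Chebyshev.map_C, Polynomial.eval_comp,
      ← Polynomial.Chebyshev.T_complex_cosh]
    simp
  rw [Polynomial.eval_mul, h1]
  simp

end Jets

section RapidlyDecreasingFamilies

open PowerSeries

/-- The weights `w` are summable against all exponentials of the frequencies `r`. -/
def IsRapid {ι : Type*} (w : ι → ℂ) (r : ι → ℤ) : Prop :=
  ∀ R : ℝ, Summable fun i => ‖w i‖ * Real.exp (R * |(r i : ℝ)|)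

variable {ι : Type*} {w : ι → ℂ} {r : ι → ℤ}

lemma IsRapid.summable_mul (h : IsRapid w r) {f : ι → ℂ} {R : ℝ}
    (hf : ∀ i, ‖f i‖ ≤ Real.exp (R * |(r i : ℝ)|)) : Summable fun i => w i * f i :=
  (h R).of_norm_bounded fun i => by
    rw [norm_mul]
    exact mul_le_mul_of_nonneg_left (hf i) (norm_nonneg _)

lemma IsRapid.summable_mul_tcoef (h : IsRapid w r) (l : ℕ) :
    Summable fun i => w i * tcoef l (r i) :=
  h.summable_mul fun i => norm_tcoef_le l (r i)

lemma norm_cosh_int_mul_le (r : ℤ) (x : ℂ) :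
    ‖cosh (r * x)‖ ≤ Real.exp (‖x‖ * |(r : ℝ)|) := by
  have h : ∀ y : ℂ, ‖y‖ = ‖x‖ * |(r : ℝ)| → ‖cexp y‖ ≤ Real.exp (‖x‖ * |(r : ℝ)|) := fun y hy =>
    (Complex.norm_exp_le_exp_norm y).trans_eq (by rw [hy])
  rw [Complex.cosh, norm_div, Complex.norm_two, div_le_iff₀ two_pos, mul_two]
  have hrx : ‖(r : ℂ) * x‖ = ‖x‖ * |(r : ℝ)| := by rw [norm_mul, Complex.norm_intCast, mul_comm]
  exact (norm_add_le _ _).trans (add_le_add (h _ hrx) (h _ (by rwa [norm_neg])))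

lemma IsRapid.summable_mul_cosh (h : IsRapid w r) (x : ℂ) :
    Summable fun i => w i * cosh (r i * x) :=
  h.summable_mul fun i => norm_cosh_int_mul_le (r i) x

lemma IsRapid.hasJet (h : IsRapid w r) : HasJet (fun x => ∑' i, w i * cosh (r i * x))
    (substCosh (mk fun l => ∑' i, w i * tcoef l (r i))) := by
  intro x
  set F : ι × ℕ → ℂ := fun p =>
    w p.1 * ((r p.1 : ℂ) ^ (2 * p.2) / (2 * p.2).factorial * (x ^ 2) ^ p.2) with hF
  have hnorm : ∀ i, HasSum (fun a => ‖F (i, a)‖) (‖w i‖ * Real.cosh (|(r i : ℝ)| * ‖x‖)) := by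
    intro i
    convert! (Real.hasSum_cosh (|(r i : ℝ)| * ‖x‖)).mul_left ‖w i‖ using 2 with a
    simp only [hF, norm_mul, norm_div, norm_pow, Complex.norm_intCast, Complex.norm_natCast]
    rw [mul_pow, pow_mul ‖x‖]
    ring
  have hsum : Summable F := by
    refine Summable.of_norm ((summable_prod_of_nonneg fun p => norm_nonneg _).2
      ⟨fun i => (hnorm i).summable, ?_⟩)
    simp only [(hnorm _).tsum_eq]
    refine (h ‖x‖).of_nonneg_of_le (fun i => by positivity) fun i => ?_
    gcongr
    rw [Real.cosh_eq, mul_comm]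
    have : Real.exp (-(‖x‖ * |(r i : ℝ)|)) ≤ Real.exp (‖x‖ * |(r i : ℝ)|) :=
      Real.exp_le_exp.2 (by have : 0 ≤ ‖x‖ * |(r i : ℝ)| := by positivity
                            linarith)
    linarith
  have h1 : HasSum (fun i => w i * cosh (r i * x)) (∑' p, F p) := by
    refine hsum.hasSum.prod_fiberwise fun i => ?_
    have := (hasJet_cosh (r i) x).mul_left (w i)
    simpa only [coeff_mk] using this
  have h2 : HasSum (fun a => ∑' i, F (i, a)) (∑' p, F p) :=
    ((Equiv.prodComm ℕ ι).hasSum_iff.2 hsum.hasSum).prod_fiberwise fun a =>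
      (hsum.comp_injective (i := fun i : ι => (i, a)) fun i j hij => (Prod.ext_iff.1 hij).1).hasSum
  rw [← h1.tsum_eq] at h2
  convert! h2 using 2 with a
  rw [coeff_substCosh _ le_rfl]
  simp only [coeff_mk, hF]
  have h3 : ∀ i, w i * ((r i : ℂ) ^ (2 * a) / (2 * a).factorial * (x ^ 2) ^ a) =
      (∑ l ∈ Finset.range (a + 1), coeff a (coshJet ^ l) * (w i * tcoef l (r i))) *
        (x ^ 2) ^ a := by
    intro i
    have := congrArg (coeff a) (jet_cosh_eq (r i))
    rw [coeff_mk, coeff_substCosh _ le_rfl] at this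
    rw [this, ← mul_assoc, Finset.mul_sum]
    congr 1
    refine Finset.sum_congr rfl fun l _ => ?_
    rw [coeff_mk]
    ring
  simp only [h3]
  rw [tsum_mul_right, Summable.tsum_finsetSum
    fun l _ => (h.summable_mul_tcoef l).mul_left _]
  simp only [tsum_mul_left]

end RapidlyDecreasingFamilies

section QSeries

open PowerSeries

variable {ι : Type*} {d : ι → ℕ} {w : ι → ℂ}

lemma hasSum_fiber_mul_pow {q z : ℂ} (h : HasSum (fun i => w i * q ^ d i) z) :
    HasSum (fun N => (∑' i : d ⁻¹' {N}, w i) * q ^ N) z := by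
  convert! h.tsum_fiberwise d using 2 with N
  rw [← tsum_mul_right]
  exact tsum_congr fun i => by rw [show d i = N from i.2]

/-- The series `∑ i, w i * q ^ d i`. -/
def qSeries (d : ι → ℕ) (w : ι → ℂ) (h : ∀ q : ℂ, ‖q‖ < 1 → Summable fun i => w i * q ^ d i) :
    convDisc :=
  ⟨mk fun N => ∑' i : d ⁻¹' {N}, w i, fun q hq => by
    simpa only [coeff_mk] using (hasSum_fiber_mul_pow (h q hq).hasSum).summable⟩

lemma coeff_qSeries (h : ∀ q : ℂ, ‖q‖ < 1 → Summable fun i => w i * q ^ d i) (N : ℕ) :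
    coeff N (qSeries d w h).1 = ∑' i : d ⁻¹' {N}, w i := by
  rw [qSeries, coeff_mk]

lemma evalDisc_qSeries (h : ∀ q : ℂ, ‖q‖ < 1 → Summable fun i => w i * q ^ d i) (q : ℂ)
    (hq : ‖q‖ < 1) : evalDisc q hq (qSeries d w h) = ∑' i, w i * q ^ d i := by
  refine (hasSum_evalDisc _ q hq).unique ?_
  simpa only [coeff_qSeries] using hasSum_fiber_mul_pow (h q hq).hasSum

lemma coeff_qSeries_mem {A : Subring ℂ}
    (h : ∀ q : ℂ, ‖q‖ < 1 → Summable fun i => w i * q ^ d i) {N : ℕ}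
    (hfin : {i | d i = N ∧ w i ≠ 0}.Finite) (hA : ∀ i, d i = N → w i ∈ A) :
    coeff N (qSeries d w h).1 ∈ A := by
  rw [coeff_qSeries, tsum_eq_finsum]
  · exact finsum_induction (· ∈ A) A.zero_mem (fun _ _ => A.add_mem) fun i => hA i i.2
  · refine (hfin.preimage Subtype.val_injective.injOn).subset fun i hi => ⟨i.2, ?_⟩
    simpa using hi

end QSeries

section ThetaSeries

open PowerSeries UpperHalfPlane
open scoped Real

lemma summable_exp_neg_sq_add (R : ℝ) {c : ℝ} (hc : 0 < c) :
    Summable fun n : ℤ => Real.exp (-c * (n : ℝ) ^ 2 + R * |(n : ℝ)|) := by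
  have := summable_pow_mul_jacobiTheta₂_term_bound (R / (2 * π)) (T := c / π) (by positivity) 0
  refine this.congr fun n => ?_
  rw [pow_zero, one_mul]
  congr 1
  field_simp
  push_cast
  ring

/-- The weights `q ^ d n` decay rapidly if `d` grows quadratically. -/
lemma isRapid_pow_of_sq_le {d : ℤ → ℕ} {r : ℤ → ℤ} (hd : ∀ n : ℤ, n ^ 2 - |n| ≤ d n)
    (hr : ∀ n : ℤ, |r n| ≤ 2 * |n| + 1) {q : ℂ} (hq : ‖q‖ < 1) : IsRapid (fun n => q ^ d n) r := by
  intro R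
  obtain ⟨c, hc, hqc⟩ : ∃ c : ℝ, 0 < c ∧ ‖q‖ ≤ Real.exp (-c) := by
    obtain ⟨ρ, h1, h2⟩ := exists_between hq
    have h0 : 0 < ρ := (norm_nonneg q).trans_lt h1
    exact ⟨-Real.log ρ, by simpa using Real.log_neg h0 h2, by
      rw [neg_neg, Real.exp_log h0]; exact h1.le⟩
  refine ((summable_exp_neg_sq_add (c + 2 * |R|) hc).mul_left (Real.exp |R|)).of_nonneg_of_le
    (fun n => by positivity) fun n => ?_
  rw [norm_pow, ← Real.exp_add]
  have hd' : ((n : ℝ)) ^ 2 - |(n : ℝ)| ≤ d n := by exact_mod_cast hd n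
  have hr' : |(r n : ℝ)| ≤ 2 * |(n : ℝ)| + 1 := by exact_mod_cast hr n
  calc ‖q‖ ^ d n * Real.exp (R * |(r n : ℝ)|)
      ≤ Real.exp (-c) ^ d n * Real.exp (|R| * (2 * |(n : ℝ)| + 1)) := by
        gcongr
        exact le_abs_self R
    _ = Real.exp (-(c * d n) + |R| * (2 * |(n : ℝ)| + 1)) := by
        rw [← Real.exp_nat_mul, ← Real.exp_add]; ring_nf
    _ ≤ _ := by
        refine Real.exp_le_exp.2 ?_
        have := mul_le_mul_of_nonneg_left hd' hc.le
        nlinarith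

lemma isRapid_even {q : ℂ} (hq : ‖q‖ < 1) :
    IsRapid (fun n : ℤ => q ^ (n ^ 2).toNat) fun n => 2 * n :=
  isRapid_pow_of_sq_le (fun n => by
    rw [Int.toNat_of_nonneg (sq_nonneg n)]; linarith [abs_nonneg n])
    (fun n => by rw [abs_mul]; simp) hq

lemma sq_add_self_nonneg (n : ℤ) : 0 ≤ n ^ 2 + n := by
  rcases le_or_gt 0 n with h | h <;> nlinarith

lemma isRapid_odd {q : ℂ} (hq : ‖q‖ < 1) :
    IsRapid (fun n : ℤ => q ^ (n ^ 2 + n).toNat) fun n => 2 * n + 1 :=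
  isRapid_pow_of_sq_le (fun n => by
    rw [Int.toNat_of_nonneg (sq_add_self_nonneg n)]; linarith [neg_abs_le n])
    (fun n => (abs_add_le _ _).trans (by rw [abs_mul]; simp)) hq

/-- The theta function `∑ n, q ^ (n ^ 2) cosh (2 n x)`. -/
def thetaEven (τ : ℍ) (x : ℂ) : ℂ := ∑' n : ℤ, nome τ ^ (n ^ 2).toNat * cosh ((2 * n : ℤ) * x)

/-- The theta function `∑ n, q ^ (n ^ 2 + n) cosh ((2 n + 1) x)`. -/
def thetaOdd (τ : ℍ) (x : ℂ) : ℂ :=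
  ∑' n : ℤ, nome τ ^ (n ^ 2 + n).toNat * cosh ((2 * n + 1 : ℤ) * x)

lemma hasSum_jacobiTheta₂_cosh (z : ℂ) {σ : ℂ} (hσ : 0 < σ.im) :
    HasSum (fun n : ℤ => cexp (π * Complex.I * n ^ 2 * σ) * cosh (n * (2 * π * Complex.I * z)))
      (jacobiTheta₂ z σ) := by
  have h1 := hasSum_jacobiTheta₂_term z hσ
  have h2 := (Equiv.neg ℤ).hasSum_iff.2 h1
  have h3 := (h1.add h2).mul_left (2⁻¹ : ℂ)
  rw [show (2 : ℂ)⁻¹ * (jacobiTheta₂ z σ + jacobiTheta₂ z σ) = jacobiTheta₂ z σ by ring] at h3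
  convert! h3 using 2 with n
  simp only [Function.comp_apply, Equiv.neg_apply, jacobiTheta₂_term, Complex.exp_add, cosh]
  push_cast
  rw [neg_sq, show (n : ℂ) * (2 * π * Complex.I * z) = 2 * π * Complex.I * n * z by ring,
    show (2 : ℂ) * π * Complex.I * -n * z = -(2 * π * Complex.I * n * z) by ring]
  ring

lemma nome_pow_toNat (τ : ℍ) {k : ℤ} (hk : 0 ≤ k) :
    nome τ ^ k.toNat = cexp (2 * π * Complex.I * k * τ) := by
  rw [nome_eq, ← Complex.exp_nat_mul]
  have : ((k.toNat : ℕ) : ℂ) = (k : ℂ) := by exact_mod_cast Int.toNat_of_nonneg hk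
  rw [this]
  ring_nf

lemma hasSum_thetaEven (τ : ℍ) (x : ℂ) :
    HasSum (fun n : ℤ => nome τ ^ (n ^ 2).toNat * cosh ((2 * n : ℤ) * x)) (thetaEven τ x) :=
  ((isRapid_even (norm_nome_lt_one τ)).summable_mul_cosh x).hasSum

lemma hasSum_thetaOdd (τ : ℍ) (x : ℂ) :
    HasSum (fun n : ℤ => nome τ ^ (n ^ 2 + n).toNat * cosh ((2 * n + 1 : ℤ) * x))
      (thetaOdd τ x) :=
  ((isRapid_odd (norm_nome_lt_one τ)).summable_mul_cosh x).hasSum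

lemma jacobiTheta₂_two_mul (τ : ℍ) (u : ℂ) :
    jacobiTheta₂ (2 * u) (2 * τ) = thetaEven τ (2 * π * Complex.I * u) := by
  have h : 0 < (2 * (τ : ℂ)).im := by simpa using τ.im_pos
  refine (hasSum_jacobiTheta₂_cosh (2 * u) h).unique ?_
  convert! hasSum_thetaEven τ (2 * π * Complex.I * u) using 3 with n
  · rw [nome_pow_toNat τ (sq_nonneg n)]
    push_cast
    ring_nf
  · push_cast
    ring_nf

lemma hasSum_int_even_add_odd {f : ℤ → ℂ} {a b : ℂ} (he : HasSum (fun k => f (2 * k)) a)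
    (ho : HasSum (fun k => f (2 * k + 1)) b) : HasSum f (a + b) := by
  have h2 : Function.Injective fun k : ℤ => 2 * k := fun i j h => by simpa using h
  have h3 : Function.Injective fun k : ℤ => 2 * k + 1 := fun i j h => by simpa using h
  have he' := h2.hasSum_range_iff.2 he
  have ho' := h3.hasSum_range_iff.2 ho
  refine he'.add_isCompl ?_ ho'
  have e1 : Set.range (fun k : ℤ => 2 * k) = {n | Even n} := by ext n; simp
  have e2 : Set.range (fun k : ℤ => 2 * k + 1) = {n | Odd n} := by ext n; simp
  rw [e1, e2]
  exact Int.isCompl_even_odd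

/-- `q ^ (1 / 4)`. -/
def nomeQuarter (τ : ℍ) : ℂ := cexp (π * Complex.I * τ / 2)

lemma nomeQuarter_pow_four (τ : ℍ) : nomeQuarter τ ^ 4 = nome τ := by
  rw [nomeQuarter, nome_eq, ← Complex.exp_nat_mul]
  push_cast
  ring_nf

lemma jacobiTheta₂_half (τ : ℍ) (u : ℂ) : jacobiTheta₂ u (τ / 2) =
    thetaEven τ (2 * π * Complex.I * u) + nomeQuarter τ * thetaOdd τ (2 * π * Complex.I * u) := by
  have h : 0 < ((τ : ℂ) / 2).im := by simpa using τ.im_pos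
  refine (hasSum_jacobiTheta₂_cosh u h).unique (hasSum_int_even_add_odd ?_ ?_)
  · convert! hasSum_thetaEven τ (2 * π * Complex.I * u) using 3 with n
    rw [nome_pow_toNat τ (sq_nonneg n)]
    push_cast
    ring_nf
  · convert! (hasSum_thetaOdd τ (2 * π * Complex.I * u)).mul_left (nomeQuarter τ) using 2 with n
    rw [nome_pow_toNat τ (sq_add_self_nonneg n), ← mul_assoc (nomeQuarter τ), nomeQuarter,
      ← Complex.exp_add]
    push_cast
    ring_nf

/-- `q ^ (1/4)`-combination of the two theta functions. -/
def thetaSum (τ : ℍ) (x : ℂ) : ℂ := thetaEven τ x + nomeQuarter τ * thetaOdd τ x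

lemma jacobiTheta₂_div_eq (z : ℂ) {σ : ℂ} (hσ : σ ≠ 0) : jacobiTheta₂ (z / σ) (-1 / σ) =
    (-Complex.I * σ) ^ (1 / 2 : ℂ) * (cexp (π * Complex.I * z ^ 2 / σ) * jacobiTheta₂ z σ) := by
  have h0 : (-Complex.I * σ) ^ (1 / 2 : ℂ) ≠ 0 := by
    rw [Ne, cpow_eq_zero_iff]
    simp [hσ]
  rw [jacobiTheta₂_functional_equation z σ, ← mul_assoc (cexp _), mul_left_comm (cexp _),
    mul_assoc, ← Complex.exp_add,
    show π * Complex.I * z ^ 2 / σ + -π * Complex.I * z ^ 2 / σ = 0 by ring]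
  field_simp
  simp

lemma thetaEven_S (τ : ℍ) (x : ℂ) : thetaEven (ModularGroup.S • τ) ((τ : ℂ)⁻¹ * x) =
    (-Complex.I * (τ / 2)) ^ (1 / 2 : ℂ) *
      (cexp ((2 * π * Complex.I * τ)⁻¹ * x ^ 2) * thetaSum τ x) := by
  have hτ := τ.ne_zero
  have hI := Complex.two_pi_I_ne_zero
  obtain ⟨u, rfl⟩ : ∃ u, x = 2 * π * Complex.I * u := ⟨x / (2 * π * Complex.I), by field_simp⟩
  have h := jacobiTheta₂_div_eq u (σ := τ / 2) (div_ne_zero hτ two_ne_zero)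
  rw [jacobiTheta₂_half] at h
  have e := jacobiTheta₂_two_mul (ModularGroup.S • τ) ((τ : ℂ)⁻¹ * u)
  rw [thetaSum,
    show (τ : ℂ)⁻¹ * (2 * π * Complex.I * u) = 2 * π * Complex.I * ((τ : ℂ)⁻¹ * u) by ring,
    ← e, modular_S_smul]
  convert! h using 2
  · field_simp
  · simp; field_simp
  · congr 2
    field_simp

lemma thetaSum_S (τ : ℍ) (x : ℂ) : thetaSum (ModularGroup.S • τ) ((τ : ℂ)⁻¹ * x) =
    (-Complex.I * (2 * τ)) ^ (1 / 2 : ℂ) *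
      (cexp ((2 * π * Complex.I * τ)⁻¹ * x ^ 2) * thetaEven τ x) := by
  have hτ := τ.ne_zero
  have hI := Complex.two_pi_I_ne_zero
  obtain ⟨u, rfl⟩ : ∃ u, x = 2 * π * Complex.I * u := ⟨x / (2 * π * Complex.I), by field_simp⟩
  have h := jacobiTheta₂_div_eq (2 * u) (σ := 2 * τ) (mul_ne_zero two_ne_zero hτ)
  rw [jacobiTheta₂_two_mul] at h
  have e := jacobiTheta₂_half (ModularGroup.S • τ) ((τ : ℂ)⁻¹ * u)
  rw [thetaSum,
    show (τ : ℂ)⁻¹ * (2 * π * Complex.I * u) = 2 * π * Complex.I * ((τ : ℂ)⁻¹ * u) by ring,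
    ← e, modular_S_smul]
  convert! h using 2
  · field_simp
  · simp; field_simp
  · congr 2
    field_simp

lemma theta_multiplier_sq (τ : ℍ) : ((-Complex.I * ((τ : ℂ) / 2)) ^ (1 / 2 : ℂ) *
    (-Complex.I * (2 * τ)) ^ (1 / 2 : ℂ)) ^ 2 = -(τ : ℂ) ^ 2 := by
  have h (z : ℂ) : (z ^ (1 / 2 : ℂ)) ^ 2 = z := by
    simp
  rw [mul_pow, h, h]
  linear_combination (τ : ℂ) ^ 2 * Complex.I_sq

end ThetaSeries

section FormalCombinations

open PowerSeries

variable {R S : Type*} [CommRing R] [CommRing S]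

/-- The combination of `a` and `b` with vanishing constant coefficient. -/
def wronskZero (a b : PowerSeries R) : PowerSeries R := C (coeff 0 a) * b - C (coeff 0 b) * a

/-- The combination of `a` and `b` with vanishing linear coefficient. -/
def wronskOne (a b : PowerSeries R) : PowerSeries R := C (coeff 1 a) * b - C (coeff 1 b) * a

/-- The linear coefficient of `wronskZero a b`. -/
def wronskConst (a b : PowerSeries R) : R := coeff 0 a * coeff 1 b - coeff 0 b * coeff 1 a

/-- The combination of `a` and `b` from which the form of weight zero is built; the scalar `ν`
accounts for the choice of coordinate. -/
def wronskMix (ν : R) (a b : PowerSeries R) : PowerSeries R :=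
  C (wronskConst a b) * wronskOne a b -
    C (coeff 2 (wronskZero a b) + ν * wronskConst a b) * wronskZero a b

lemma coeff_zero_wronskZero (a b : PowerSeries R) : coeff 0 (wronskZero a b) = 0 := by
  simp [wronskZero]; ring

lemma coeff_one_wronskZero (a b : PowerSeries R) :
    coeff 1 (wronskZero a b) = wronskConst a b := by
  simp [wronskZero, wronskConst]

lemma coeff_zero_wronskMix (ν : R) (a b : PowerSeries R) :
    coeff 0 (wronskMix ν a b) = -wronskConst a b ^ 2 := by
  rw [wronskMix, map_sub, coeff_C_mul, coeff_C_mul, coeff_zero_wronskZero]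
  simp [wronskOne, wronskConst]; ring

lemma map_wronskZero (f : R →+* S) (a b : PowerSeries R) :
    PowerSeries.map f (wronskZero a b) =
      wronskZero (PowerSeries.map f a) (PowerSeries.map f b) := by
  simp [wronskZero]

lemma map_wronskConst (f : R →+* S) (a b : PowerSeries R) :
    f (wronskConst a b) = wronskConst (PowerSeries.map f a) (PowerSeries.map f b) := by
  simp [wronskConst]

lemma map_wronskMix (f : R →+* S) (ν : R) (a b : PowerSeries R) :
    PowerSeries.map f (wronskMix ν a b) =
      wronskMix (f ν) (PowerSeries.map f a) (PowerSeries.map f b) := by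
  have h : coeff 2 (wronskZero (PowerSeries.map f a) (PowerSeries.map f b)) =
      f (coeff 2 (wronskZero a b)) := by
    rw [← map_wronskZero, PowerSeries.coeff_map]
  simp only [wronskMix, map_sub, map_mul, map_C, map_wronskZero, map_add, ← map_wronskConst f,
    wronskOne, PowerSeries.coeff_map, h]

lemma rescale_C (r z : R) : rescale r (C z) = C z := by
  ext n
  rw [coeff_rescale, coeff_C]
  split_ifs with h <;> simp [h]

section Complex

variable (a b : PowerSeries ℂ)

lemma coeff_zero_substCosh : coeff 0 (substCosh a) = coeff 0 a := by
  rw [coeff_substCosh a le_rfl]; simp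

lemma coeff_one_substCosh : coeff 1 (substCosh a) = coeff 1 a := by
  rw [coeff_substCosh a le_rfl]; simp [Finset.sum_range_succ, coeff_one_coshJet, coeff_one]

lemma coeff_two_substCosh : coeff 2 (substCosh a) = coeff 2 a + 12⁻¹ * coeff 1 a := by
  rw [coeff_substCosh a le_rfl]
  simp [Finset.sum_range_succ, coeff_coshJet_pow_self, coeff_two_coshJet, coeff_one]
  ring

lemma substCosh_C (c : ℂ) : substCosh (C c) = C c := substCosh.commutes c

lemma substCosh_wronskZero :
    substCosh (wronskZero a b) = wronskZero (substCosh a) (substCosh b) := by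
  simp only [wronskZero, map_sub, map_mul, substCosh_C, coeff_zero_substCosh]

lemma wronskConst_substCosh :
    wronskConst (substCosh a) (substCosh b) = wronskConst a b := by
  simp only [wronskConst, coeff_zero_substCosh, coeff_one_substCosh]

lemma substCosh_wronskMix :
    substCosh (wronskMix 12⁻¹ a b) = wronskMix 0 (substCosh a) (substCosh b) := by
  simp only [wronskMix, wronskOne, map_sub, map_mul, substCosh_C, substCosh_wronskZero,
    coeff_one_substCosh, wronskConst_substCosh]
  rw [← substCosh_wronskZero, coeff_two_substCosh, coeff_one_wronskZero, zero_mul, add_zero]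

variable {a b}
variable {a' b' e : PowerSeries ℂ} {s t τ c₀ : ℂ}

lemma wronskConst_transform (hτ : τ ≠ 0) (he0 : coeff 0 e = 1)
    (ha : rescale (τ⁻¹ ^ 2) a' = C s * (e * b)) (hb : rescale (τ⁻¹ ^ 2) b' = C t * (e * a)) :
    rescale (τ⁻¹ ^ 2) (wronskZero a' b') = C (-(s * t)) * (e * wronskZero a b) ∧
      wronskConst a' b' = -(s * t) * τ ^ 2 * wronskConst a b := by
  have ha0 : coeff 0 a' = s * coeff 0 b := by
    simpa [coeff_rescale, coeff_mul, he0] using congrArg (coeff 0) ha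
  have hb0 : coeff 0 b' = t * coeff 0 a := by
    simpa [coeff_rescale, coeff_mul, he0] using congrArg (coeff 0) hb
  have h1 : rescale (τ⁻¹ ^ 2) (wronskZero a' b') = C (-(s * t)) * (e * wronskZero a b) := by
    have hC (z : ℂ) : rescale (τ⁻¹ ^ 2) (C z) = C z := rescale_C _ _
    simp only [wronskZero, map_sub, map_mul, hC, ha, hb, ha0, hb0, map_neg]
    ring
  refine ⟨h1, ?_⟩
  have h2 := congrArg (coeff 1) h1
  rw [coeff_rescale, coeff_C_mul, coeff_mul, Finset.Nat.sum_antidiagonal_succ] at h2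
  simp only [coeff_one_wronskZero, he0, Finset.Nat.antidiagonal_zero, Finset.sum_singleton,
    coeff_zero_wronskZero, zero_add] at h2
  have : τ ^ 2 * τ⁻¹ ^ 2 = 1 := by field_simp
  linear_combination τ ^ 2 * h2 - wronskConst a' b' * this

lemma wronskMix_transform (hτ : τ ≠ 0) (he0 : coeff 0 e = 1) (he1 : coeff 1 e = c₀)
    (ha : rescale (τ⁻¹ ^ 2) a' = C s * (e * b)) (hb : rescale (τ⁻¹ ^ 2) b' = C t * (e * a)) :
    rescale (τ⁻¹ ^ 2) (wronskMix 0 a' b') =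
      C ((s * t) ^ 2 * τ ^ 4) * (e * wronskMix 0 a b) := by
  obtain ⟨h1, h2⟩ := wronskConst_transform hτ he0 ha hb
  have hτ2 : τ ^ 2 * τ⁻¹ ^ 2 = 1 := by field_simp
  have hone (u v : PowerSeries ℂ) : coeff 1 (u * v) = coeff 0 u * coeff 1 v +
      coeff 1 u * coeff 0 v := by
    rw [coeff_mul, Finset.Nat.sum_antidiagonal_succ]
    simp
  have htwo (u v : PowerSeries ℂ) : coeff 2 (u * v) = coeff 0 u * coeff 2 v +
      coeff 1 u * coeff 1 v + coeff 2 u * coeff 0 v := by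
    rw [coeff_mul, Finset.Nat.sum_antidiagonal_succ, Finset.Nat.sum_antidiagonal_succ]
    simp
    ring
  have ha1 : coeff 1 a' = τ ^ 2 * (s * (coeff 1 b + c₀ * coeff 0 b)) := by
    have := congrArg (coeff 1) ha
    rw [coeff_rescale, coeff_C_mul, hone, he0, he1] at this
    linear_combination τ ^ 2 * this - coeff 1 a' * hτ2
  have hb1 : coeff 1 b' = τ ^ 2 * (t * (coeff 1 a + c₀ * coeff 0 a)) := by
    have := congrArg (coeff 1) hb
    rw [coeff_rescale, coeff_C_mul, hone, he0, he1] at this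
    linear_combination τ ^ 2 * this - coeff 1 b' * hτ2
  have hK2 : coeff 2 (wronskZero a' b') =
      τ ^ 4 * (-(s * t) * (coeff 2 (wronskZero a b) + c₀ * wronskConst a b)) := by
    have := congrArg (coeff 2) h1
    rw [coeff_rescale, coeff_C_mul, htwo, he0, he1, coeff_zero_wronskZero,
      coeff_one_wronskZero] at this
    have hτ4 : τ ^ 4 * (τ⁻¹ ^ 2) ^ 2 = 1 := by field_simp
    linear_combination τ ^ 4 * this - coeff 2 (wronskZero a' b') * hτ4
  have hC (z : ℂ) : rescale (τ⁻¹ ^ 2) (C z) = C z := rescale_C _ _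
  have hL : rescale (τ⁻¹ ^ 2) (wronskOne a' b') =
      C (-(s * t) * τ ^ 2) * (e * (wronskOne a b + C c₀ * wronskZero a b)) := by
    simp only [wronskOne, wronskZero, map_sub, map_mul, hC, ha, hb, ha1, hb1, map_neg, map_add]
    ring
  simp only [wronskMix, map_sub, map_mul, hC, hL, h1, h2, hK2, map_neg, map_add, zero_mul,
    map_pow, add_zero]
  ring

end Complex

lemma wronskZero_add_smul (a b : PowerSeries R) (c : R) :
    wronskZero a (a + C c * b) = C c * wronskZero a b := by
  simp [wronskZero]; ring

lemma wronskConst_add_smul (a b : PowerSeries R) (c : R) :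
    wronskConst a (a + C c * b) = c * wronskConst a b := by
  simp [wronskConst]; ring

lemma wronskMix_add_smul (ν : R) (a b : PowerSeries R) (c : R) :
    wronskMix ν a (a + C c * b) = C (c ^ 2) * wronskMix ν a b := by
  simp only [wronskMix, wronskOne, wronskZero_add_smul, wronskConst_add_smul, map_add, map_mul,
    coeff_C_mul, map_pow]
  ring

end FormalCombinations

section IntegralSeries

open PowerSeries UpperHalfPlane
open scoped Real

variable (A : Subring ℂ)

/-- The convergent series with coefficients in `A`. -/
def intDisc : Subring convDisc := (coeffsIn A ⊤).comap convDisc.subtype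

/-- Evaluation of an `A`-integral series at the nome of `τ`. -/
def evalInt (τ : ℍ) : intDisc A →+* ℂ := (evalQ τ).comp (intDisc A).subtype

variable {A} {d : ℤ → ℕ} {r : ℤ → ℤ}

lemma IsRapid.summable_tcoef_mul_pow (h : ∀ q : ℂ, ‖q‖ < 1 → IsRapid (fun n => q ^ d n) r)
    (l : ℕ) (q : ℂ) (hq : ‖q‖ < 1) : Summable fun n => tcoef l (r n) * q ^ d n := by
  simpa only [mul_comm] using (h q hq).summable_mul_tcoef l

lemma finite_fiber_of_sq_le (hd : ∀ n : ℤ, n ^ 2 - |n| ≤ d n) (N : ℕ) : {n | d n = N}.Finite := by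
  refine (Set.finite_Icc (-(N + 1 : ℤ)) (N + 1)).subset fun n hn => ?_
  rw [Set.mem_ofPred_eq] at hn
  have h1 := hd n
  rw [hn, ← sq_abs] at h1
  exact abs_le.1 (by nlinarith [sq_nonneg (|n| - 1)])

/-- The series `∑ n, q ^ d n * tcoef l (r n)`, as a power series indexed by `l`. -/
def thetaJet (hA : (12 : ℂ)⁻¹ ∈ A) (hd : ∀ n : ℤ, n ^ 2 - |n| ≤ d n)
    (h : ∀ q : ℂ, ‖q‖ < 1 → IsRapid (fun n => q ^ d n) r) : PowerSeries (intDisc A) :=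
  mk fun l => ⟨qSeries d (fun n => tcoef l (r n)) (IsRapid.summable_tcoef_mul_pow h l),
    fun N _ => coeff_qSeries_mem (IsRapid.summable_tcoef_mul_pow h l)
      ((finite_fiber_of_sq_le hd N).subset fun _ hn => hn.1)
      fun n _ => tcoef_mem (by
        have := A.mul_mem (natCast_mem A 6) hA
        norm_num at this
        simpa using this) l (r n)⟩

lemma hasJet_thetaJet (hA : (12 : ℂ)⁻¹ ∈ A) (hd : ∀ n : ℤ, n ^ 2 - |n| ≤ d n)
    (h : ∀ q : ℂ, ‖q‖ < 1 → IsRapid (fun n => q ^ d n) r) (τ : ℍ) :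
    HasJet (fun x => ∑' n, nome τ ^ d n * cosh (r n * x))
      (substCosh (PowerSeries.map (evalInt A τ) (thetaJet hA hd h))) := by
  convert! (h (nome τ) (norm_nome_lt_one τ)).hasJet using 2
  ext l
  rw [PowerSeries.coeff_map, thetaJet, coeff_mk, coeff_mk, evalInt, RingHom.comp_apply,
    Subring.subtype_apply, evalQ, evalDisc_qSeries]
  simp only [mul_comm]

lemma coeff_zero_thetaJet (hA : (12 : ℂ)⁻¹ ∈ A) (hd : ∀ n : ℤ, n ^ 2 - |n| ≤ d n)
    (h : ∀ q : ℂ, ‖q‖ < 1 → IsRapid (fun n => q ^ d n) r) (l : ℕ) :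
    coeff 0 (coeff l (thetaJet hA hd h)).1.1 = ∑ n ∈ {n ∈ ({-1, 0, 1} : Finset ℤ) | d n = 0},
      tcoef l (r n) := by
  rw [thetaJet, coeff_mk, coeff_qSeries]
  rw [← Finset.tsum_subtype]
  refine tsum_congr_set_coe (fun n => tcoef l (r n)) ?_
  ext n
  simp only [Set.mem_preimage, Set.mem_singleton_iff, Finset.coe_filter, Set.mem_ofPred_eq]
  refine ⟨fun hn => ⟨?_, hn⟩, fun hn => hn.2⟩
  have h1 := hd n
  rw [hn, ← sq_abs] at h1
  have h2 : |n| ≤ 1 := by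
    by_contra! h3
    push_cast at h1
    nlinarith
  obtain ⟨h3, h4⟩ := abs_le.1 h2
  interval_cases n <;> simp

lemma sq_sub_abs_le_even (n : ℤ) : n ^ 2 - |n| ≤ (n ^ 2).toNat := by
  rw [Int.toNat_of_nonneg (sq_nonneg n)]; linarith [abs_nonneg n]

lemma sq_sub_abs_le_odd (n : ℤ) : n ^ 2 - |n| ≤ (n ^ 2 + n).toNat := by
  rw [Int.toNat_of_nonneg (sq_add_self_nonneg n)]; linarith [neg_abs_le n]

/-- The jet of `thetaEven` in the coordinate `2 cosh x - 2`. -/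
def evenJet (hA : (12 : ℂ)⁻¹ ∈ A) : PowerSeries (intDisc A) :=
  thetaJet hA sq_sub_abs_le_even fun _ => isRapid_even

/-- The jet of `thetaOdd` in the coordinate `2 cosh x - 2`. -/
def oddJet (hA : (12 : ℂ)⁻¹ ∈ A) : PowerSeries (intDisc A) :=
  thetaJet hA sq_sub_abs_le_odd fun _ => isRapid_odd

variable (hA : (12 : ℂ)⁻¹ ∈ A)

/-- The jet of `thetaSum` in the coordinate `2 cosh x - 2`. -/
def sumJet (τ : ℍ) : PowerSeries ℂ :=
  PowerSeries.map (evalInt A τ) (evenJet hA) +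
    C (nomeQuarter τ) * PowerSeries.map (evalInt A τ) (oddJet hA)

lemma hasJet_evenJet (τ : ℍ) :
    HasJet (thetaEven τ) (substCosh (PowerSeries.map (evalInt A τ) (evenJet hA))) :=
  hasJet_thetaJet hA _ _ τ

lemma hasJet_sumJet (τ : ℍ) : HasJet (thetaSum τ) (substCosh (sumJet hA τ)) := by
  rw [sumJet, map_add, map_mul, substCosh_C]
  exact (hasJet_evenJet hA τ).add ((hasJet_thetaJet hA _ _ τ).const_mul _)

/-- The factor `exp (x² / (2 π i τ))` as a power series in `x²`. -/
def heatFactor (τ : ℍ) : PowerSeries ℂ := rescale (2 * π * Complex.I * τ)⁻¹ (PowerSeries.exp ℂ)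

lemma coeff_zero_heatFactor (τ : ℍ) : coeff 0 (heatFactor τ) = 1 := by
  simp [heatFactor, coeff_rescale]

lemma evenJet_S (τ : ℍ) : rescale ((τ : ℂ)⁻¹ ^ 2)
    (substCosh (PowerSeries.map (evalInt A (ModularGroup.S • τ)) (evenJet hA))) =
      C ((-Complex.I * (τ / 2)) ^ (1 / 2 : ℂ)) * (heatFactor τ * substCosh (sumJet hA τ)) :=
  (hasJet_sumJet hA τ).rescale_eq (hasJet_evenJet hA _) (thetaEven_S τ)

lemma sumJet_S (τ : ℍ) : rescale ((τ : ℂ)⁻¹ ^ 2) (substCosh (sumJet hA (ModularGroup.S • τ))) =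
    C ((-Complex.I * (2 * τ)) ^ (1 / 2 : ℂ)) *
      (heatFactor τ * substCosh (PowerSeries.map (evalInt A τ) (evenJet hA))) :=
  (hasJet_evenJet hA τ).rescale_eq (hasJet_sumJet hA _) (thetaSum_S τ)

/-- The normalizing constant of the two theta jets. -/
def thetaWronsk : intDisc A := wronskConst (evenJet hA) (oddJet hA)

lemma coeff_zero_thetaWronsk : coeff 0 (thetaWronsk hA).1.1 = 1 := by
  have he (l : ℕ) : coeff 0 (coeff l (evenJet hA)).1.1 = tcoef l 0 := by
    rw [evenJet, coeff_zero_thetaJet, show ({n ∈ ({-1, 0, 1} : Finset ℤ) | (n ^ 2).toNat = 0}) = {0}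
      by decide]
    simp
  have ho (l : ℕ) : coeff 0 (coeff l (oddJet hA)).1.1 = tcoef l (-1) + tcoef l 1 := by
    rw [oddJet, coeff_zero_thetaJet,
      show ({n ∈ ({-1, 0, 1} : Finset ℤ) | (n ^ 2 + n).toNat = 0}) = {-1, 0} by decide]
    simp
  have : (thetaWronsk hA).1.1 = (coeff 0 (evenJet hA)).1.1 * (coeff 1 (oddJet hA)).1.1 -
    (coeff 0 (oddJet hA)).1.1 * (coeff 1 (evenJet hA)).1.1 := rfl
  have hm (F G : PowerSeries ℂ) : coeff 0 (F * G) = coeff 0 F * coeff 0 G := by simp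
  rw [this, map_sub, hm, hm, he, he, ho, ho, tcoef_zero_zero, tcoef_neg,
    tcoef_neg, tcoef_zero_one, tcoef_eq_zero (l := 1) (r := 0) (by simp),
    show tcoef 1 1 = 1 / 2 from tcoef_natAbs (r := 1) one_ne_zero]
  norm_num

lemma wronskConst_sumJet (τ : ℍ) :
    wronskConst (PowerSeries.map (evalInt A τ) (evenJet hA)) (sumJet hA τ) =
      nomeQuarter τ * evalInt A τ (thetaWronsk hA) := by
  rw [sumJet, wronskConst_add_smul, thetaWronsk, map_wronskConst]

lemma thetaWronsk_S (τ : ℍ) :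
    nomeQuarter (ModularGroup.S • τ) * evalInt A (ModularGroup.S • τ) (thetaWronsk hA) =
      -((-Complex.I * ((τ : ℂ) / 2)) ^ (1 / 2 : ℂ) * (-Complex.I * (2 * τ)) ^ (1 / 2 : ℂ)) *
        (τ : ℂ) ^ 2 * (nomeQuarter τ * evalInt A τ (thetaWronsk hA)) := by
  have h := (wronskConst_transform τ.ne_zero (coeff_zero_heatFactor τ)
    (evenJet_S hA τ) (sumJet_S hA τ)).2
  rwa [wronskConst_substCosh, wronskConst_substCosh, wronskConst_sumJet,
    wronskConst_sumJet] at h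

/-- The constant series. -/
def constDisc (c : ℂ) : convDisc := ⟨C c, fun q _ => by
  refine summable_of_ne_finset_zero (s := {0}) fun n hn => ?_
  rw [coeff_C, if_neg (by simpa using hn), zero_mul]⟩

lemma evalDisc_constDisc (c q : ℂ) (hq : ‖q‖ < 1) : evalDisc q hq (constDisc c) = c := by
  refine (hasSum_evalDisc _ q hq).unique ?_
  convert! hasSum_single (0 : ℕ) fun n hn => ?_
  · simp [constDisc]
  · simp [constDisc, coeff_C, hn]

/-- The series `q`. -/
def qDisc : convDisc := ⟨X, fun q _ => by
  refine summable_of_ne_finset_zero (s := {1}) fun n hn => ?_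
  rw [coeff_X, if_neg (by simpa using hn), zero_mul]⟩

lemma evalDisc_qDisc (q : ℂ) (hq : ‖q‖ < 1) : evalDisc q hq qDisc = q := by
  refine (hasSum_evalDisc _ q hq).unique ?_
  convert! hasSum_single (1 : ℕ) fun n hn => ?_
  · simp [qDisc]
  · simp [qDisc, coeff_X, hn]

lemma evalQ_qDisc (τ : ℍ) : evalQ τ qDisc = nome τ := evalDisc_qDisc _ _

lemma isModularSeries_thetaWronsk :
    IsModularSeries 12 (qDisc * (thetaWronsk hA).1 ^ 4) := by
  intro τ
  have h := congrArg (· ^ 4) (thetaWronsk_S hA τ)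
  simp only [mul_pow, nomeQuarter_pow_four] at h
  have h2 := theta_multiplier_sq τ
  rw [map_mul, map_mul, evalQ_qDisc, evalQ_qDisc, map_pow, map_pow]
  refine h.trans ?_
  rw [neg_pow, show ((-Complex.I * ((τ : ℂ) / 2)) ^ (1 / 2 : ℂ) *
    (-Complex.I * (2 * τ)) ^ (1 / 2 : ℂ)) ^ 4 = (-(τ : ℂ) ^ 2) ^ 2 by rw [← h2]; ring]
  change _ = (τ : ℂ) ^ (12 : ℤ) * (nome τ * evalInt A τ (thetaWronsk hA) ^ 4)
  rw [show ((τ : ℂ) ^ (12 : ℤ)) = (τ : ℂ) ^ 12 from zpow_natCast _ 12]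
  ring

lemma evalDisc_thetaWronsk_ne_zero (q : ℂ) (hq : ‖q‖ < 1) :
    evalDisc q hq (thetaWronsk hA).1 ≠ 0 := by
  rcases eq_or_ne q 0 with rfl | h0
  · rw [evalDisc_zero, coeff_zero_thetaWronsk]
    exact one_ne_zero
  obtain ⟨τ, rfl⟩ := exists_nome_eq hq h0
  have h1 : coeff 1 (qDisc * (thetaWronsk hA).1 ^ 4).1 = 1 := by
    have : (qDisc * (thetaWronsk hA).1 ^ 4).1 = X * (thetaWronsk hA).1.1 ^ 4 := rfl
    rw [this, show (1 : ℕ) = 0 + 1 from rfl, coeff_succ_X_mul, coeff_zero_eq_constantCoeff_apply,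
      map_pow, ← coeff_zero_eq_constantCoeff_apply, coeff_zero_thetaWronsk, one_pow]
  have := (isModularSeries_thetaWronsk hA).evalQ_ne_zero_of_weight_twelve
    (by change coeff 0 (X * (thetaWronsk hA).1.1 ^ 4) = 0; simp)
    (fun h => by rw [h] at h1; simp at h1) τ
  rw [map_mul, map_pow] at this
  exact fun h => this (by rw [show evalQ τ (thetaWronsk hA).1 = 0 from h]; simp)

lemma isUnit_thetaWronsk : IsUnit (thetaWronsk hA) := by
  obtain ⟨G, hG⟩ := (isUnit_convDisc _ (evalDisc_thetaWronsk_ne_zero hA)).exists_right_inv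
  have hmem : G.1 ∈ coeffsIn A ⊤ := by
    refine coeff_mem_of_mul_of_constantCoeff_one (thetaWronsk hA).2 (coeff_zero_thetaWronsk hA) ?_
    have h : (thetaWronsk hA).1.1 * G.1 = 1 := congrArg Subtype.val hG
    exact h.symm ▸ one_mem (coeffsIn A ⊤)
  exact .of_mul_eq_one ⟨G, hmem⟩ (Subtype.ext hG)

/-- Generators over the ring of modular forms of the even weak Jacobi forms of index one. -/
theorem exists_jacobi_generators (hA : (12 : ℂ)⁻¹ ∈ A) : ∃ P Q : PowerSeries (intDisc A),
    coeff 0 P = 0 ∧ coeff 1 P = 1 ∧ coeff 0 Q = -1 ∧ ∀ τ : ℍ,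
      rescale ((τ : ℂ)⁻¹ ^ 2) (substCosh (PowerSeries.map (evalInt A (ModularGroup.S • τ)) P)) =
          C ((τ : ℂ)⁻¹ ^ 2) * (heatFactor τ * substCosh (PowerSeries.map (evalInt A τ) P)) ∧
        rescale ((τ : ℂ)⁻¹ ^ 2) (substCosh (PowerSeries.map (evalInt A (ModularGroup.S • τ)) Q)) =
          heatFactor τ * substCosh (PowerSeries.map (evalInt A τ) Q) := by
  obtain ⟨κ, hκ⟩ := (isUnit_thetaWronsk hA).exists_left_inv
  set ν : intDisc A := ⟨constDisc 12⁻¹, C_mem_coeffsIn hA⟩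
  have hντ (τ : ℍ) : evalInt A τ ν = 12⁻¹ := evalDisc_constDisc _ _ (norm_nome_lt_one τ)
  refine ⟨C κ * wronskZero (evenJet hA) (oddJet hA),
    C (κ ^ 2) * wronskMix ν (evenJet hA) (oddJet hA), ?_, ?_, ?_, fun τ => ?_⟩
  · rw [coeff_C_mul, coeff_zero_wronskZero, mul_zero]
  · rw [coeff_C_mul, coeff_one_wronskZero]; exact hκ
  · rw [coeff_C_mul, coeff_zero_wronskMix, mul_neg, ← mul_pow]
    exact congrArg (fun z => -z ^ 2) hκ |>.trans (by simp)
  have hκτ (τ : ℍ) : nomeQuarter τ * evalInt A τ (thetaWronsk hA) ≠ 0 ∧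
      evalInt A τ κ = nomeQuarter τ * (nomeQuarter τ * evalInt A τ (thetaWronsk hA))⁻¹ := by
    have h := congrArg (evalInt A τ) hκ
    rw [map_mul, map_one] at h
    have h1 : nomeQuarter τ ≠ 0 := Complex.exp_ne_zero _
    have h2 : evalInt A τ (thetaWronsk hA) ≠ 0 := right_ne_zero_of_mul_eq_one h
    refine ⟨mul_ne_zero h1 h2, ?_⟩
    field_simp
    exact h
  have hP (τ : ℍ) : substCosh (PowerSeries.map (evalInt A τ)
      (C κ * wronskZero (evenJet hA) (oddJet hA))) =
      C (nomeQuarter τ * evalInt A τ (thetaWronsk hA))⁻¹ *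
        wronskZero (substCosh (PowerSeries.map (evalInt A τ) (evenJet hA)))
          (substCosh (sumJet hA τ)) := by
    rw [map_mul, map_C, map_wronskZero, map_mul, substCosh_C, ← substCosh_wronskZero, sumJet,
      wronskZero_add_smul, map_mul, substCosh_C, (hκτ τ).2, map_mul]
    ring
  have hQ (τ : ℍ) : substCosh (PowerSeries.map (evalInt A τ)
      (C (κ ^ 2) * wronskMix ν (evenJet hA) (oddJet hA))) =
      C ((nomeQuarter τ * evalInt A τ (thetaWronsk hA))⁻¹ ^ 2) *
        wronskMix 0 (substCosh (PowerSeries.map (evalInt A τ) (evenJet hA)))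
          (substCosh (sumJet hA τ)) := by
    rw [map_mul, map_C, map_wronskMix, hντ, map_mul, substCosh_C, ← substCosh_wronskMix, sumJet,
      wronskMix_add_smul, map_mul, substCosh_C, map_pow, (hκτ τ).2, mul_pow, map_mul]
    ring
  have h1 := (wronskConst_transform τ.ne_zero (coeff_zero_heatFactor τ)
    (evenJet_S hA τ) (sumJet_S hA τ)).1
  have h2 := wronskMix_transform τ.ne_zero (coeff_zero_heatFactor τ) rfl
    (evenJet_S hA τ) (sumJet_S hA τ)
  have hg := thetaWronsk_S hA τ
  have hg0 := (hκτ τ).1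
  have hg1 := (hκτ (ModularGroup.S • τ)).1
  have hτ := τ.ne_zero
  rw [hP, hP, hQ, hQ, map_mul, map_mul, rescale_C, rescale_C, h1, h2]
  generalize (-Complex.I * ((τ : ℂ) / 2)) ^ (1 / 2 : ℂ) * (-Complex.I * (2 * τ)) ^ (1 / 2 : ℂ) = st
    at *
  generalize nomeQuarter τ * evalInt A τ (thetaWronsk hA) = g at *
  generalize nomeQuarter (ModularGroup.S • τ) * evalInt A (ModularGroup.S • τ) (thetaWronsk hA) = g'
    at *
  subst hg
  have hst : st ≠ 0 := by rintro rfl; simp at hg1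
  constructor
  · rw [← mul_assoc, ← map_mul, mul_left_comm (heatFactor τ), ← mul_assoc (C _) (C _), ← map_mul]
    congr 2
    field_simp
  · rw [← mul_assoc, ← map_mul, mul_left_comm (heatFactor τ)]
    congr 2
    field_simp

end IntegralSeries

section JetMatrices

open PowerSeries

variable (m : ℕ)

/-- The matrix of `substCosh` on jets of order `m`. -/
def coshMatrix : Matrix (Fin (m + 1)) (Fin (m + 1)) ℂ :=
  Matrix.of fun a l => coeff (a : ℕ) (coshJet ^ (l : ℕ))

/-- The matrix of multiplication by `e` on jets of order `m`. -/
def mulMatrix (e : PowerSeries ℂ) : Matrix (Fin (m + 1)) (Fin (m + 1)) ℂ :=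
  Matrix.of fun a b => if b ≤ a then coeff ((a : ℕ) - b) e else 0

variable {m}

lemma coeff_substCosh_eq_sum (F : PowerSeries ℂ) (a : Fin (m + 1)) :
    coeff (a : ℕ) (substCosh F) = ∑ l, coshMatrix m a l * coeff (l : ℕ) F := by
  rw [coeff_substCosh F (Nat.lt_succ_iff.1 a.2), Finset.sum_range]
  rfl

lemma coeff_mul_eq_sum (e G : PowerSeries ℂ) (a : Fin (m + 1)) :
    coeff (a : ℕ) (e * G) = ∑ b, mulMatrix m e a b * coeff (b : ℕ) G := by
  have h : ∀ b : Fin (m + 1), mulMatrix m e a b * coeff (b : ℕ) G =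
      (fun b : ℕ => if b ∈ Finset.range (a + 1) then coeff (a - b) e * coeff b G else 0) b := by
    intro b
    simp only [mulMatrix, Matrix.of_apply, Fin.le_def, Finset.mem_range, Nat.lt_succ_iff, ite_mul,
      zero_mul]
  rw [Finset.sum_congr rfl fun b _ => h b, ← Finset.sum_range
      fun b : ℕ => if b ∈ Finset.range (a + 1) then coeff (a - b) e * coeff b G else 0,
    ← Finset.sum_filter, mul_comm e, coeff_mul, Finset.Nat.sum_antidiagonal_eq_sum_range_succ_mk]
  refine Finset.sum_congr ?_ fun b _ => mul_comm _ _
  ext b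
  simp only [Finset.mem_range, Finset.mem_filter]
  omega

lemma isUnit_of_lowerTriangular {R : Type*} [CommRing R] {M : Matrix (Fin m) (Fin m) R}
    (h : ∀ i j, i < j → M i j = 0) (hd : ∀ i, IsUnit (M i i)) : IsUnit M := by
  rw [Matrix.isUnit_iff_isUnit_det,
    Matrix.det_of_isLowerTriangular M fun i j hij => h i j (OrderDual.toDual_lt_toDual.1 hij)]
  exact IsUnit.prod_univ_iff.2 hd

lemma isUnit_coshMatrix : IsUnit (coshMatrix m) :=
  isUnit_of_lowerTriangular (fun _ _ hij => coeff_coshJet_pow_eq_zero hij) fun i => by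
    simp [coshMatrix, coeff_coshJet_pow_self]

lemma isUnit_mulMatrix {e : PowerSeries ℂ} (he : coeff 0 e = 1) : IsUnit (mulMatrix m e) :=
  isUnit_of_lowerTriangular (fun _ _ hij => if_neg hij.not_ge) fun i => by
    simp only [mulMatrix, Matrix.of_apply, le_refl, if_true, Nat.sub_self, he, isUnit_one]

end JetMatrices

section JacobiCoefficients

open PowerSeries UpperHalfPlane
open scoped Real

/-- The factor `exp (m x² / (2 π i τ))` as a power series in `x²`. -/
def indexFactor (m : ℕ) (τ : ℍ) : PowerSeries ℂ :=
  rescale (m * (2 * π * Complex.I * τ)⁻¹) (PowerSeries.exp ℂ)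

lemma heatFactor_pow (m : ℕ) (τ : ℍ) : heatFactor τ ^ m = indexFactor m τ := by
  rw [heatFactor, indexFactor, ← map_pow, PowerSeries.exp_pow_eq_rescale_exp, rescale_rescale,
    mul_comm]

lemma coeff_zero_indexFactor (m : ℕ) (τ : ℍ) : coeff 0 (indexFactor m τ) = 1 := by
  simp [indexFactor, coeff_rescale]

/-- The two-variable function with Fourier coefficients `c (n, r, s)`. -/
def fourierJacobi (c : ℤ × ℤ × ℤ → ℂ) (τ : ℍ) (x y : ℂ) : ℂ :=
  ∑' p : ℤ × ℤ × ℤ, c p * nome τ ^ p.1.toNat * (cosh (p.2.1 * x) * cosh (p.2.2 * y))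

/-- The Fourier coefficients of an even Jacobi form of weight `k` and index `m` for the Gaussian
lattice. -/
structure IsJacobiCoeff (k : ℤ) (m : ℕ) (c : ℤ × ℤ × ℤ → ℂ) : Prop where
  nonneg : ∀ p, c p ≠ 0 → 0 ≤ p.1
  sq_add_sq_le : ∀ p, c p ≠ 0 → p.2.1 ^ 2 + p.2.2 ^ 2 ≤ 4 * m * p.1
  even_left : ∀ n r s, c (n, -r, s) = c (n, r, s)
  even_right : ∀ n r s, c (n, r, -s) = c (n, r, s)
  elliptic_left : ∀ n r s, c (n + r + m, r + 2 * m, s) = c (n, r, s)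
  elliptic_right : ∀ n r s, c (n + s + m, r, s + 2 * m) = c (n, r, s)
  rapid : ∀ q : ℂ, ‖q‖ < 1 → ∀ R : ℝ, Summable fun p : ℤ × ℤ × ℤ =>
    ‖c p * q ^ p.1.toNat‖ * Real.exp (R * (|(p.2.1 : ℝ)| + |(p.2.2 : ℝ)|))
  transform : ∀ (τ : ℍ) (x y : ℂ),
    fourierJacobi c (ModularGroup.S • τ) ((τ : ℂ)⁻¹ * x) ((τ : ℂ)⁻¹ * y) =
      (τ : ℂ) ^ k * (cexp (m * (2 * π * Complex.I * τ)⁻¹ * (x ^ 2 + y ^ 2)) * fourierJacobi c τ x y)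

namespace IsJacobiCoeff

variable {k : ℤ} {m : ℕ} {c : ℤ × ℤ × ℤ → ℂ}

lemma isRapid_left (hc : IsJacobiCoeff k m c) {q : ℂ} (hq : ‖q‖ < 1) {f : ℤ → ℂ} {R : ℝ}
    (hf : ∀ s, ‖f s‖ ≤ Real.exp (R * |(s : ℝ)|)) :
    IsRapid (fun p : ℤ × ℤ × ℤ => c p * q ^ p.1.toNat * f p.2.2) fun p => p.2.1 := fun R' => by
  refine (hc.rapid q hq (max R R')).of_nonneg_of_le (fun p => by positivity) fun p => ?_
  rw [norm_mul _ (f _), mul_assoc, mul_add, Real.exp_add, mul_comm (Real.exp _)]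
  gcongr
  · exact (hf _).trans (Real.exp_le_exp.2 (by gcongr; exact le_max_left _ _))
  · exact le_max_right _ _

lemma isRapid_right (hc : IsJacobiCoeff k m c) {q : ℂ} (hq : ‖q‖ < 1) {f : ℤ → ℂ} {R : ℝ}
    (hf : ∀ r, ‖f r‖ ≤ Real.exp (R * |(r : ℝ)|)) :
    IsRapid (fun p : ℤ × ℤ × ℤ => c p * q ^ p.1.toNat * f p.2.1) fun p => p.2.2 := fun R' => by
  refine (hc.rapid q hq (max R R')).of_nonneg_of_le (fun p => by positivity) fun p => ?_
  rw [norm_mul _ (f _), mul_assoc, mul_add, Real.exp_add]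
  gcongr
  · exact (hf _).trans (Real.exp_le_exp.2 (by gcongr; exact le_max_left _ _))
  · exact le_max_right _ _

lemma summable_taylor (hc : IsJacobiCoeff k m c) (l l' : ℕ) (q : ℂ) (hq : ‖q‖ < 1) :
    Summable fun p : ℤ × ℤ × ℤ =>
    c p * (tcoef l p.2.1 * tcoef l' p.2.2) * q ^ p.1.toNat := by
  refine ((hc.isRapid_right hq (norm_tcoef_le l)).summable_mul_tcoef l').congr fun p => ?_
  ring

/-- The Taylor coefficients in the coordinates `2 cosh x - 2` and `2 cosh y - 2`. -/
def taylor (hc : IsJacobiCoeff k m c) (l l' : ℕ) : convDisc :=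
  qSeries (fun p : ℤ × ℤ × ℤ => p.1.toNat) (fun p => c p * (tcoef l p.2.1 * tcoef l' p.2.2))
    (hc.summable_taylor l l')

/-- The matrix of Taylor coefficients of order at most `m`. -/
def taylorMatrix (hc : IsJacobiCoeff k m c) : Matrix (Fin (m + 1)) (Fin (m + 1)) convDisc :=
  Matrix.of fun l l' => hc.taylor l l'

/-- The Taylor coefficients in the first variable. -/
def partialTaylor (c : ℤ × ℤ × ℤ → ℂ) (τ : ℍ) (l : ℕ) (y : ℂ) : ℂ :=
  ∑' p : ℤ × ℤ × ℤ, c p * nome τ ^ p.1.toNat * tcoef l p.2.1 * cosh (p.2.2 * y)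

lemma hasJet_left (hc : IsJacobiCoeff k m c) (τ : ℍ) (y : ℂ) :
    HasJet (fun x => fourierJacobi c τ x y)
      (substCosh (PowerSeries.mk fun l => partialTaylor c τ l y)) := by
  convert! (hc.isRapid_left (norm_nome_lt_one τ) fun s => norm_cosh_int_mul_le s y).hasJet using 1
  · ext x
    exact tsum_congr fun p => by ring
  · congr 2
    ext l
    exact tsum_congr fun p => by ring

lemma hasJet_partialTaylor (hc : IsJacobiCoeff k m c) (τ : ℍ) (l : ℕ) :
    HasJet (partialTaylor c τ l)
      (substCosh (PowerSeries.mk fun l' => evalQ τ (hc.taylor l l'))) := by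
  convert! (hc.isRapid_right (norm_nome_lt_one τ) (norm_tcoef_le l)).hasJet using 3
  ext l'
  rw [taylor, evalQ, evalDisc_qSeries]
  exact tsum_congr fun p => by ring

lemma hasJet_sum_partialTaylor (hc : IsJacobiCoeff k m c) (τ : ℍ) (a : Fin (m + 1)) :
    HasJet (fun y => coeff (a : ℕ) (substCosh (PowerSeries.mk fun l => partialTaylor c τ l y)))
      (∑ l : Fin (m + 1), C (coshMatrix m a l) *
        substCosh (PowerSeries.mk fun l' => evalQ τ (hc.taylor l l'))) := by
  simp only [coeff_substCosh_eq_sum, coeff_mk]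
  exact .sum _ fun l _ => (hc.hasJet_partialTaylor τ l).const_mul _

/-- The jet matrix in the variables `x` and `y`. -/
def jetMatrix (hc : IsJacobiCoeff k m c) (τ : ℍ) : Matrix (Fin (m + 1)) (Fin (m + 1)) ℂ :=
  coshMatrix m * hc.taylorMatrix.map (evalQ τ) * (coshMatrix m)ᵀ

lemma coeff_sum_partialTaylor (hc : IsJacobiCoeff k m c) (τ : ℍ) (a a' : Fin (m + 1)) :
    coeff (a' : ℕ) (∑ l : Fin (m + 1), C (coshMatrix m a l) *
        substCosh (PowerSeries.mk fun l' => evalQ τ (hc.taylor l l'))) = hc.jetMatrix τ a a' := by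
  simp only [map_sum, coeff_C_mul, coeff_substCosh_eq_sum, coeff_mk, jetMatrix, Matrix.mul_apply,
    Matrix.transpose_apply, Matrix.map_apply, taylorMatrix, Matrix.of_apply, Finset.mul_sum,
    Finset.sum_mul]
  rw [Finset.sum_comm]
  exact Finset.sum_congr rfl fun _ _ => Finset.sum_congr rfl fun _ _ => by ring

lemma jetMatrix_S (hc : IsJacobiCoeff k m c) (τ : ℍ) :
    Matrix.diagonal (fun a : Fin (m + 1) => ((τ : ℂ)⁻¹ ^ 2) ^ (a : ℕ)) *
        hc.jetMatrix (ModularGroup.S • τ) *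
        Matrix.diagonal (fun a : Fin (m + 1) => ((τ : ℂ)⁻¹ ^ 2) ^ (a : ℕ)) =
      (τ : ℂ) ^ k • (mulMatrix m (indexFactor m τ) * hc.jetMatrix τ *
        (mulMatrix m (indexFactor m τ))ᵀ) := by
  ext a a'
  have h1 (y : ℂ) := (hc.hasJet_left τ y).rescale_eq
    (hc.hasJet_left (ModularGroup.S • τ) ((τ : ℂ)⁻¹ * y))
    (t := (τ : ℂ)⁻¹) (μ := m * (2 * π * Complex.I * τ)⁻¹)
    (c := (τ : ℂ) ^ k * cexp (m * (2 * π * Complex.I * τ)⁻¹ * y ^ 2)) fun x => by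
      rw [hc.transform, mul_add, Complex.exp_add]
      ring
  have h2 (y : ℂ) := congrArg (coeff (a : ℕ)) (h1 y)
  simp only [coeff_rescale, coeff_C_mul] at h2
  have h3 := (HasJet.sum Finset.univ fun b (_ : b ∈ Finset.univ) =>
    (hc.hasJet_sum_partialTaylor τ b).const_mul (mulMatrix m (indexFactor m τ) a b)).rescale_eq
    ((hc.hasJet_sum_partialTaylor (ModularGroup.S • τ) a).const_mul (((τ : ℂ)⁻¹ ^ 2) ^ (a : ℕ)))
    (t := (τ : ℂ)⁻¹) (μ := m * (2 * π * Complex.I * τ)⁻¹) (c := (τ : ℂ) ^ k) fun y => by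
      rw [h2 y, ← indexFactor, coeff_mul_eq_sum, mul_assoc]
  have h4 := congrArg (coeff (a' : ℕ)) h3
  rw [coeff_rescale, coeff_C_mul, coeff_C_mul, coeff_sum_partialTaylor, ← indexFactor,
    coeff_mul_eq_sum] at h4
  rw [Matrix.mul_diagonal, Matrix.diagonal_mul, Matrix.smul_apply, Matrix.mul_apply, mul_comm, h4,
    smul_eq_mul]
  congr 1
  refine Finset.sum_congr rfl fun b _ => ?_
  rw [Matrix.transpose_apply, Matrix.mul_apply, mul_comm, map_sum]
  congr 1
  exact Finset.sum_congr rfl fun i _ => by rw [coeff_C_mul, coeff_sum_partialTaylor]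

end IsJacobiCoeff

end JacobiCoefficients

section GeneratorMatrix

open PowerSeries UpperHalfPlane

variable {R : Type*} [CommRing R]

/-- The matrix of coefficients of the monomials `P ^ j * Q ^ (m - j)`. -/
def monomialMatrix (m : ℕ) (P Q : PowerSeries R) : Matrix (Fin (m + 1)) (Fin (m + 1)) R :=
  Matrix.of fun l j => coeff (l : ℕ) (P ^ (j : ℕ) * Q ^ (m - j))

lemma isUnit_monomialMatrix {m : ℕ} {P Q : PowerSeries R} (h0 : coeff 0 P = 0)
    (h1 : coeff 1 P = 1) (hQ : coeff 0 Q = -1) : IsUnit (monomialMatrix m P Q) := by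
  obtain ⟨P', rfl⟩ := X_dvd_iff.2 ((coeff_zero_eq_constantCoeff_apply P).symm.trans h0)
  have hP' : constantCoeff P' = 1 := by
    rw [← h1, show (1 : ℕ) = 0 + 1 from rfl, coeff_succ_X_mul, coeff_zero_eq_constantCoeff_apply]
  refine isUnit_of_lowerTriangular (fun i j hij => ?_) fun i => ?_
  · rw [monomialMatrix, Matrix.of_apply, mul_pow, mul_assoc, coeff_X_pow_mul',
      if_neg (Nat.not_le.2 hij)]
  · rw [monomialMatrix, Matrix.of_apply, mul_pow, mul_assoc, coeff_X_pow_mul', if_pos le_rfl,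
      Nat.sub_self, coeff_zero_eq_constantCoeff_apply, map_mul, map_pow, map_pow, hP', one_pow,
      one_mul, ← coeff_zero_eq_constantCoeff_apply, hQ]
    exact (isUnit_one.neg).pow _

lemma monomialMatrix_map {S : Type*} [CommRing S] (f : R →+* S) (m : ℕ) (P Q : PowerSeries R) :
    (monomialMatrix m P Q).map f =
      monomialMatrix m (PowerSeries.map f P) (PowerSeries.map f Q) := by
  ext l j
  simp only [monomialMatrix, Matrix.map_apply, Matrix.of_apply, ← map_pow, ← map_mul,
    PowerSeries.coeff_map]

lemma monomialMatrix_transform {m : ℕ} {P Q P' Q' e : PowerSeries ℂ} {t : ℂ}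
    (hP : rescale t (substCosh P') = C t * (e * substCosh P))
    (hQ : rescale t (substCosh Q') = e * substCosh Q) :
    Matrix.diagonal (fun a : Fin (m + 1) => t ^ (a : ℕ)) * coshMatrix m * monomialMatrix m P' Q' =
      mulMatrix m (e ^ m) * coshMatrix m * monomialMatrix m P Q *
        Matrix.diagonal (fun a : Fin (m + 1) => t ^ (a : ℕ)) := by
  ext a j
  have h : rescale t (substCosh (P' ^ (j : ℕ) * Q' ^ (m - j))) =
      C (t ^ (j : ℕ)) * (e ^ m * substCosh (P ^ (j : ℕ) * Q ^ (m - j))) := by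
    have hm : e ^ m = e ^ (j : ℕ) * e ^ (m - j) := by
      rw [← pow_add, Nat.add_sub_cancel' (Nat.lt_succ_iff.1 j.2)]
    simp only [map_mul, map_pow, hP, hQ, hm]
    ring
  have h1 := congrArg (coeff (a : ℕ)) h
  rw [coeff_rescale, coeff_C_mul, coeff_mul_eq_sum, coeff_substCosh_eq_sum] at h1
  simp only [coeff_substCosh_eq_sum] at h1
  rw [Matrix.mul_diagonal, Matrix.mul_assoc, Matrix.diagonal_mul, Matrix.mul_apply,
    Matrix.mul_assoc, Matrix.mul_apply]
  simp only [Matrix.mul_apply]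
  exact h1.trans (mul_comm _ _)

end GeneratorMatrix

section SturmBound

open PowerSeries UpperHalfPlane

variable {A : Subring ℂ}

lemma conj_mem {R n : Type*} [CommRing R] [Fintype n] {B B' : Subring R} (hB : B ≤ B')
    (W : Matrix n n B) {T : Matrix n n R} (hT : ∀ i j, T i j ∈ B') (i j : n) :
    (W.map B.subtype * T * (W.map B.subtype)ᵀ) i j ∈ B' := by
  simp only [Matrix.mul_apply, Matrix.transpose_apply, Matrix.map_apply, Subring.subtype_apply]
  exact sum_mem fun a _ => mul_mem (sum_mem fun b _ => mul_mem (hB (W i b).2) (hT b a))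
    (hB (W j a).2)

lemma mem_of_conj_mem {R n : Type*} [CommRing R] [Fintype n] [DecidableEq n] {B : Subring R}
    {W : Matrix n n B} (hW : IsUnit W) {G : Matrix n n R}
    (h : ∀ i j, (W.map B.subtype * G * (W.map B.subtype)ᵀ) i j ∈ B) (i j : n) : G i j ∈ B := by
  have h1 : W⁻¹.map B.subtype * W.map B.subtype = 1 := by
    rw [← Matrix.map_mul, Matrix.nonsing_inv_mul _ ((Matrix.isUnit_iff_isUnit_det _).1 hW),
      Matrix.map_one _ (map_zero _) (map_one _)]
  have h2 : (W.map B.subtype)ᵀ * (W⁻¹.map B.subtype)ᵀ = 1 := by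
    rw [← Matrix.transpose_mul, h1, Matrix.transpose_one]
  have h3 : W⁻¹.map B.subtype * (W.map B.subtype * G * (W.map B.subtype)ᵀ) *
      (W⁻¹.map B.subtype)ᵀ = G := by
    calc _ = (W⁻¹.map B.subtype * W.map B.subtype) * G *
          ((W.map B.subtype)ᵀ * (W⁻¹.map B.subtype)ᵀ) := by simp only [Matrix.mul_assoc]
      _ = G := by rw [h1, h2, Matrix.one_mul, Matrix.mul_one]
  rw [← h3]
  exact conj_mem le_rfl _ h i j

/-- The number of integers with given absolute value. -/
def absMult (a : ℕ) : ℂ := if a = 0 then 1 else 2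

lemma sum_Icc_even {F : ℤ → ℂ} (hF : ∀ r, F (-r) = F r) (m : ℕ) :
    ∑ r ∈ Finset.Icc (-(m : ℤ)) m, F r = ∑ a : Fin (m + 1), absMult a * F (a : ℕ) := by
  rw [Finset.sum_Icc_of_even_eq_range hF, ← Finset.sum_range fun a : ℕ => absMult a * F a,
    Finset.sum_range_succ', Finset.sum_range_succ']
  simp [absMult, Finset.mul_sum]
  ring

/-- The matrix relating Fourier coefficients to Taylor coefficients. -/
def boxMatrix (hA : (2 : ℂ)⁻¹ ∈ A) (m : ℕ) : Matrix (Fin (m + 1)) (Fin (m + 1)) A :=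
  Matrix.of fun l a => ⟨absMult a * tcoef l (a : ℕ), A.mul_mem
    (by rw [absMult]; split_ifs <;> [exact A.one_mem; exact ofNat_mem A 2]) (tcoef_mem hA _ _)⟩

lemma isUnit_boxMatrix (hA : (2 : ℂ)⁻¹ ∈ A) (m : ℕ) : IsUnit (boxMatrix hA m) := by
  rw [← Matrix.isUnit_transpose]
  refine isUnit_of_lowerTriangular (fun i j hij => Subtype.ext ?_) fun i => ?_
  · exact (congrArg _ (tcoef_eq_zero (by simpa using hij))).trans (mul_zero _)
  · convert! isUnit_one
    refine Subtype.ext ?_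
    rcases eq_or_ne i 0 with rfl | h
    · simp [boxMatrix, absMult, tcoef_zero_zero]
    · have := tcoef_natAbs (r := ((i : ℕ) : ℤ)) (by simpa using h)
      rw [Int.natAbs_natCast] at this
      simp [boxMatrix, absMult, h, this]

namespace IsJacobiCoeff

variable {k : ℤ} {m : ℕ} {c : ℤ × ℤ × ℤ → ℂ}

/-- The coordinates of the Taylor matrix with respect to the monomials in the generators are
modular. -/
lemma exists_modular_coordinates (hc : IsJacobiCoeff k m c) (hA : (12 : ℂ)⁻¹ ∈ A) :
    ∃ W W' : Matrix (Fin (m + 1)) (Fin (m + 1)) (intDisc A),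
      ∃ H : Matrix (Fin (m + 1)) (Fin (m + 1)) convDisc,
        H = W'.map (intDisc A).subtype * hc.taylorMatrix * (W'.map (intDisc A).subtype)ᵀ ∧
        hc.taylorMatrix = W.map (intDisc A).subtype * H * (W.map (intDisc A).subtype)ᵀ ∧
        ∀ i j : Fin (m + 1), IsModularSeries (k + 2 * (i : ℕ) + 2 * (j : ℕ)) (H i j) := by
  obtain ⟨P, Q, h0, h1, hQ, hS⟩ := exists_jacobi_generators hA
  set W := monomialMatrix m P Q with hW
  have hWu : IsUnit W := isUnit_monomialMatrix h0 h1 hQ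
  have hW1 : W * W⁻¹ = 1 := Matrix.mul_nonsing_inv _ ((Matrix.isUnit_iff_isUnit_det _).1 hWu)
  have hW2 : W.map (intDisc A).subtype * W⁻¹.map (intDisc A).subtype = 1 := by
    rw [← Matrix.map_mul, hW1, Matrix.map_one _ (map_zero _) (map_one _)]
  set H := W⁻¹.map (intDisc A).subtype * hc.taylorMatrix * (W⁻¹.map (intDisc A).subtype)ᵀ with hH
  have hT : hc.taylorMatrix = W.map (intDisc A).subtype * H * (W.map (intDisc A).subtype)ᵀ := by
    have hW3 : (W⁻¹.map (intDisc A).subtype)ᵀ * (W.map (intDisc A).subtype)ᵀ = 1 := by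
      rw [← Matrix.transpose_mul, hW2, Matrix.transpose_one]
    calc hc.taylorMatrix = (W.map (intDisc A).subtype * W⁻¹.map (intDisc A).subtype) *
          hc.taylorMatrix * ((W⁻¹.map (intDisc A).subtype)ᵀ * (W.map (intDisc A).subtype)ᵀ) := by
            rw [hW2, hW3, Matrix.one_mul, Matrix.mul_one]
      _ = _ := by simp only [hH, Matrix.mul_assoc]
  refine ⟨W, W⁻¹, H, hH, hT, fun i j τ => ?_⟩
  have hev (τ : ℍ) : hc.jetMatrix τ =
      coshMatrix m * W.map (evalInt A τ) * H.map (evalQ τ) *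
        (coshMatrix m * W.map (evalInt A τ))ᵀ := by
    have : hc.taylorMatrix.map (evalQ τ) =
        W.map (evalInt A τ) * H.map (evalQ τ) * (W.map (evalInt A τ))ᵀ := by
      conv_lhs => rw [hT]
      rw [Matrix.map_mul, Matrix.map_mul, Matrix.transpose_map, Matrix.map_map]
      rfl
    rw [jetMatrix, this, Matrix.transpose_mul]
    simp only [Matrix.mul_assoc]
  obtain ⟨hSP, hSQ⟩ := hS τ
  have hV := monomialMatrix_transform (m := m) hSP hSQ
  rw [heatFactor_pow, ← monomialMatrix_map, ← monomialMatrix_map, ← hW] at hV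
  have hE := hc.jetMatrix_S τ
  rw [hev, hev] at hE
  set D := Matrix.diagonal fun a : Fin (m + 1) => ((τ : ℂ)⁻¹ ^ 2) ^ (a : ℕ) with hD
  set V := mulMatrix m (indexFactor m τ) * coshMatrix m * W.map (evalInt A τ) with hVdef
  have hVu : IsUnit V := by
    refine ((isUnit_mulMatrix (coeff_zero_indexFactor m τ)).mul isUnit_coshMatrix).mul ?_
    exact hWu.map (evalInt A τ).mapMatrix
  have key : V * (D * H.map (evalQ (ModularGroup.S • τ)) * D) * Vᵀ =
      V * ((τ : ℂ) ^ k • H.map (evalQ τ)) * Vᵀ := by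
    have hDt : Dᵀ = D := Matrix.diagonal_transpose _
    calc V * (D * H.map (evalQ (ModularGroup.S • τ)) * D) * Vᵀ
        = (V * D) * H.map (evalQ (ModularGroup.S • τ)) * (V * D)ᵀ := by
          rw [Matrix.transpose_mul V, hDt]; simp only [Matrix.mul_assoc]
      _ = D * (coshMatrix m * W.map (evalInt A (ModularGroup.S • τ)) *
          H.map (evalQ (ModularGroup.S • τ)) *
          (coshMatrix m * W.map (evalInt A (ModularGroup.S • τ)))ᵀ) * D := by
          rw [← hV, Matrix.mul_assoc D, Matrix.transpose_mul D, hDt]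
          simp only [Matrix.mul_assoc]
      _ = _ := by
          rw [hE, hVdef, Matrix.mul_assoc (mulMatrix m _) (coshMatrix m), Matrix.transpose_mul
            (mulMatrix m _)]
          simp only [Matrix.mul_assoc, Matrix.smul_mul, Matrix.mul_smul]
  have key2 := hVu.mul_left_cancel ((Matrix.isUnit_transpose _).2 hVu |>.mul_right_cancel key)
  have key3 := congrFun (congrFun key2 i) j
  rw [hD, Matrix.mul_diagonal, Matrix.diagonal_mul, Matrix.smul_apply, Matrix.map_apply,
    Matrix.map_apply, smul_eq_mul] at key3
  have hτ := τ.ne_zero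
  rw [zpow_add₀ hτ, zpow_add₀ hτ, _root_.zpow_mul, _root_.zpow_mul, zpow_natCast, zpow_natCast]
  have hz : ((τ : ℂ) ^ (2 : ℤ)) = (τ : ℂ) ^ 2 := zpow_natCast _ 2
  have hi (n : ℕ) : ((τ : ℂ) ^ 2) ^ n * ((τ : ℂ)⁻¹ ^ 2) ^ n = 1 := by
    rw [← mul_pow, ← mul_pow, mul_inv_cancel₀ hτ, one_pow, one_pow]
  rw [hz]
  linear_combination ((τ : ℂ) ^ 2) ^ (i : ℕ) * ((τ : ℂ) ^ 2) ^ (j : ℕ) * key3 -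
    evalQ (ModularGroup.S • τ) (H i j) *
      (hi j + ((τ : ℂ) ^ 2) ^ (j : ℕ) * ((τ : ℂ)⁻¹ ^ 2) ^ (j : ℕ) * hi i)

lemma abs_le_of_ne_zero (hc : IsJacobiCoeff k m c) {p : ℤ × ℤ × ℤ} (hp : c p ≠ 0) :
    |p.2.1| ≤ 4 * m * p.1 ∧ |p.2.2| ≤ 4 * m * p.1 := by
  have h1 := hc.sq_add_sq_le p hp
  have hle (a : ℤ) : |a| ≤ a ^ 2 := by
    rw [← sq_abs]
    rcases (abs_nonneg a).eq_or_lt with h | h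
    · rw [← h]; simp
    · nlinarith
  constructor
  · linarith [hle p.2.1, sq_nonneg p.2.2]
  · linarith [hle p.2.2, sq_nonneg p.2.1]

lemma toNat_eq_iff (hc : IsJacobiCoeff k m c) {p : ℤ × ℤ × ℤ} (hp : c p ≠ 0) {N : ℕ}
    (h : p.1.toNat = N) : p.1 = N := by
  rw [← h, Int.toNat_of_nonneg (hc.nonneg p hp)]

lemma coeff_taylor_mem (hc : IsJacobiCoeff k m c) (hA : (2 : ℂ)⁻¹ ∈ A) {N : ℕ}
    (h : ∀ r s, c (N, r, s) ∈ A) (l l' : ℕ) : coeff N (hc.taylor l l').1 ∈ A := by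
  refine coeff_qSeries_mem (hc.summable_taylor l l') ?_ fun p hp => ?_
  · refine (Set.finite_Icc ((N : ℤ), -(4 * m * N : ℤ), -(4 * m * N : ℤ))
      ((N : ℤ), (4 * m * N : ℤ), (4 * m * N : ℤ))).subset fun p hp => ?_
    have hp0 := left_ne_zero_of_mul hp.2
    have h1 := hc.toNat_eq_iff hp0 hp.1
    obtain ⟨h2, h3⟩ := hc.abs_le_of_ne_zero hp0
    rw [h1, abs_le] at h2 h3
    exact ⟨⟨h1.ge, h2.1, h3.1⟩, ⟨h1.le, h2.2, h3.2⟩⟩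
  · rcases eq_or_ne (c p) 0 with h0 | h0
    · rw [h0, zero_mul]
      exact A.zero_mem
    · have h1 := hc.toNat_eq_iff h0 hp
      have := h p.2.1 p.2.2
      rw [← h1] at this
      exact mul_mem this (mul_mem (tcoef_mem hA _ _) (tcoef_mem hA _ _))

lemma coeff_taylor (hc : IsJacobiCoeff k m c) (N l l' : ℕ) {M : ℤ} (hM : 4 * m * N ≤ M) :
    coeff N (hc.taylor l l').1 = ∑ x ∈ Finset.Icc (-M) M ×ˢ Finset.Icc (-M) M,
      c (N, x) * (tcoef l x.1 * tcoef l' x.2) := by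
  rw [taylor, coeff_qSeries]
  have hinj : Function.Injective fun x : ℤ × ℤ => ((N : ℤ), x) := fun x y h => (Prod.ext_iff.1 h).2
  rw [tsum_subtype ((fun p : ℤ × ℤ × ℤ => p.1.toNat) ⁻¹' {N})
      fun p => c p * (tcoef l p.2.1 * tcoef l' p.2.2),
    tsum_eq_sum (s := (Finset.Icc (-M) M ×ˢ Finset.Icc (-M) M).map ⟨_, hinj⟩), Finset.sum_map]
  · refine Finset.sum_congr rfl fun x _ => Set.indicator_of_mem ?_ _
    simp
  · intro p hp
    by_contra h0
    obtain ⟨h1, h2⟩ : p.1.toNat = N ∧ c p * (tcoef l p.2.1 * tcoef l' p.2.2) ≠ 0 := by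
      simpa using h0
    have hp0 := left_ne_zero_of_mul h2
    have h3 := hc.toNat_eq_iff hp0 h1
    obtain ⟨h4, h5⟩ := hc.abs_le_of_ne_zero hp0
    rw [h3] at h4 h5
    refine hp (Finset.mem_map.2 ⟨p.2, ?_, Prod.ext h3.symm rfl⟩)
    rw [Finset.mem_product, Finset.mem_Icc, Finset.mem_Icc]
    exact ⟨abs_le.1 (h4.trans hM), abs_le.1 (h5.trans hM)⟩

lemma box_mem (hc : IsJacobiCoeff k m c) (hA : (2 : ℂ)⁻¹ ∈ A) {N : ℤ}
    (h : ∀ l l' : Fin (m + 1), ∑ x ∈ Finset.Icc (-(m : ℤ)) m ×ˢ Finset.Icc (-(m : ℤ)) m,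
      c (N, x) * (tcoef l x.1 * tcoef l' x.2) ∈ A) (a b : Fin (m + 1)) :
    c (N, (a : ℕ), (b : ℕ)) ∈ A := by
  refine mem_of_conj_mem (isUnit_boxMatrix hA m) (G := Matrix.of fun a b : Fin (m + 1) =>
    c (N, (a : ℕ), (b : ℕ))) (fun l l' => ?_) a b
  convert! h l l' using 1
  have hs (r : ℤ) := sum_Icc_even (F := fun s => c (N, r, s) * (tcoef l r * tcoef l' s)) (m := m)
    fun s => by simp only [hc.even_right, tcoef_neg]
  rw [Finset.sum_product, sum_Icc_even fun r => by simp only [hc.even_left, tcoef_neg]]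
  simp only [hs]
  simp only [Matrix.mul_apply, Matrix.transpose_apply, Matrix.map_apply, Subring.subtype_apply,
    Matrix.of_apply, boxMatrix, Finset.mul_sum, Finset.sum_mul]
  rw [Finset.sum_comm]
  exact Finset.sum_congr rfl fun _ _ => Finset.sum_congr rfl fun _ _ => by ring

lemma mem_of_taylor_mem (hc : IsJacobiCoeff k m c) (hA : (2 : ℂ)⁻¹ ∈ A)
    (h : ∀ (l l' : Fin (m + 1)) (N : ℕ), coeff N (hc.taylor l l').1 ∈ A) (p : ℤ × ℤ × ℤ) :
    c p ∈ A := by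
  have key : ∀ (N : ℕ) (n r s : ℤ), n ≤ N → c (n, r, s) ∈ A := by
    intro N
    induction N using Nat.strong_induction_on with
    | _ N ih =>
    have ih' : ∀ n r s : ℤ, n < N → c (n, r, s) ∈ A := by
      intro n r s hn
      rcases lt_or_ge n 0 with h0 | h0
      · by_contra h1
        exact absurd (hc.nonneg _ fun h2 => h1 (h2 ▸ A.zero_mem)) (not_le.2 h0)
      · lift n to ℕ using h0
        exact ih n (by exact_mod_cast hn) n r s le_rfl
    have hleft : ∀ r s : ℤ, m < |r| → c (N, r, s) ∈ A := by
      intro r s hr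
      have h1 : c (N, r, s) = c (N, |r|, s) := by
        rcases abs_choice r with h | h <;> rw [h]
        exact (hc.even_left _ _ _).symm
      have h2 := hc.elliptic_left (N - |r| + m) (|r| - 2 * m) s
      rw [show (N : ℤ) - |r| + m + (|r| - 2 * m) + m = N by ring, sub_add_cancel] at h2
      rw [h1, h2]
      exact ih' _ _ _ (by linarith)
    have hright : ∀ r s : ℤ, m < |s| → c (N, r, s) ∈ A := by
      intro r s hs
      have h1 : c (N, r, s) = c (N, r, |s|) := by
        rcases abs_choice s with h | h <;> rw [h]
        exact (hc.even_right _ _ _).symm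
      have h2 := hc.elliptic_right (N - |s| + m) r (|s| - 2 * m)
      rw [show (N : ℤ) - |s| + m + (|s| - 2 * m) + m = N by ring, sub_add_cancel] at h2
      rw [h1, h2]
      exact ih' _ _ _ (by linarith)
    have hbox := hc.box_mem hA (N := N) fun l l' => by
      have hM := h l l' N
      rw [hc.coeff_taylor N l l' (le_max_right (m : ℤ) _)] at hM
      set M := max (m : ℤ) (4 * m * N)
      have hsub : Finset.Icc (-(m : ℤ)) m ×ˢ Finset.Icc (-(m : ℤ)) m ⊆
          Finset.Icc (-M) M ×ˢ Finset.Icc (-M) M := by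
        have : (m : ℤ) ≤ M := le_max_left _ _
        exact Finset.product_subset_product (Finset.Icc_subset_Icc (by linarith) this)
          (Finset.Icc_subset_Icc (by linarith) this)
      rw [← Finset.sum_sdiff hsub] at hM
      refine (add_mem_cancel_left (sum_mem fun x hx => ?_)).1 hM
      refine mul_mem ?_ (mul_mem (tcoef_mem hA _ _) (tcoef_mem hA _ _))
      simp only [Finset.mem_sdiff, Finset.mem_product, Finset.mem_Icc, ← abs_le, not_and_or,
        not_le] at hx
      exact hx.2.elim (hleft _ _) (hright _ _)
    intro n r s hn
    rcases hn.lt_or_eq with hn | rfl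
    · exact ih' n r s hn
    rcases lt_or_ge (m : ℤ) |r| with hr | hr
    · exact hleft r s hr
    rcases lt_or_ge (m : ℤ) |s| with hs | hs
    · exact hright r s hs
    have := hbox ⟨r.natAbs, by rw [← Int.natCast_natAbs] at hr; omega⟩
      ⟨s.natAbs, by rw [← Int.natCast_natAbs] at hs; omega⟩
    rw [Int.natCast_natAbs, Int.natCast_natAbs] at this
    rcases abs_choice r with h1 | h1 <;> rcases abs_choice s with h2 | h2 <;>
      rw [h1, h2] at this <;> simpa only [hc.even_left, hc.even_right] using this
  exact key p.1.toNat p.1 p.2.1 p.2.2 (Int.self_le_toNat _)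

/-- A Sturm bound for even Jacobi forms over the Gaussian lattice. -/
theorem mem_of_sturm (hc : IsJacobiCoeff k m c) (hA : (12 : ℂ)⁻¹ ∈ A)
    (h : ∀ n r s : ℤ, 12 * n ≤ k + 4 * m → c (n, r, s) ∈ A) (p : ℤ × ℤ × ℤ) : c p ∈ A := by
  have hA2 : (2 : ℂ)⁻¹ ∈ A := by
    have := A.mul_mem (natCast_mem A 6) hA
    norm_num at this
    simpa using this
  obtain ⟨W, W', H, hH, hT, hmod⟩ := hc.exists_modular_coordinates hA
  set D : LowerSet ℕ := ⟨{n | 12 * (n : ℤ) ≤ k + 4 * m}, fun a b hab ha => by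
    have : (b : ℤ) ≤ a := by exact_mod_cast hab
    exact (by linarith : 12 * (b : ℤ) ≤ _).trans ha⟩
  have h1 : ∀ i j, H i j ∈ (coeffsIn A D).comap convDisc.subtype := by
    rw [hH]
    have hle : intDisc A ≤ (coeffsIn A D).comap convDisc.subtype := fun _ hF n _ => hF n trivial
    exact conj_mem hle W' fun i j n hn =>
      hc.coeff_taylor_mem hA2 (fun r s => h n r s hn) i j
  have h2 : ∀ i j, H i j ∈ intDisc A := fun i j =>
    (hmod i j).mem_coeffsIn hA fun n hn => h1 i j n (hn.trans (by
      have := i.2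
      have := j.2
      omega))
  have h3 : ∀ i j, hc.taylorMatrix i j ∈ intDisc A := by
    rw [hT]
    exact conj_mem le_rfl W h2
  exact hc.mem_of_taylor_mem hA2 (fun l l' N => h3 l l' N trivial) p

end IsJacobiCoeff

end SturmBound

section FourierUniqueness

open Real

/-- The character `exp (2πinx)` of the circle. -/
def circleChar (n : ℤ) (x : ℝ) : ℂ := cexp (2 * π * Complex.I * (n * x))

lemma norm_circleChar (n : ℤ) (x : ℝ) : ‖circleChar n x‖ = 1 := by
  rw [circleChar, show 2 * π * Complex.I * (n * x) = ((2 * π * (n * x) : ℝ) : ℂ) * Complex.I by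
    push_cast; ring, norm_exp_ofReal_mul_I]

lemma integral_circleChar (n : ℤ) : ∫ x in (0 : ℝ)..1, circleChar n x = if n = 0 then 1 else 0 := by
  split_ifs with h
  · simp [h, circleChar]
  · have h0 : (2 * π * Complex.I * n : ℂ) ≠ 0 := mul_ne_zero two_pi_I_ne_zero (by exact_mod_cast h)
    have := integral_exp_mul_complex (a := 0) (b := 1) h0
    simp only [circleChar, ← mul_assoc]
    rw [this, show (2 * π * Complex.I * n : ℂ) * (1 : ℝ) = n * (2 * π * Complex.I) by
      push_cast; ring, exp_int_mul_two_pi_mul_I]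
    simp

lemma circleChar_add (n m : ℤ) (x : ℝ) :
    circleChar (n + m) x = circleChar n x * circleChar m x := by
  rw [circleChar, circleChar, circleChar, ← Complex.exp_add]
  push_cast
  ring_nf

lemma continuous_circleChar (n : ℤ) : Continuous (circleChar n) := by
  unfold circleChar
  fun_prop

/-- Extraction of the homogeneous part of given degree of an absolutely convergent series. -/
lemma tsum_ite_eq_integral {ι : Type*} [Countable ι] {d : ι → ℂ} (hd : Summable d) (deg : ι → ℤ)
    (m : ℤ) : ∑' i, (if deg i = m then d i else 0) =
      ∫ x in (0 : ℝ)..1, (∑' i, d i * circleChar (deg i) x) * circleChar (-m) x := by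
  have hF (i : ι) : Continuous fun x : ℝ => d i * circleChar (deg i - m) x :=
    continuous_const.mul (continuous_circleChar _)
  have := intervalIntegral.hasSum_intervalIntegral_of_summable_norm (a := 0) (b := 1)
    (f := fun i => ⟨_, hF i⟩) (Summable.of_nonneg_of_le (fun _ => norm_nonneg _) (fun i => by
      refine (ContinuousMap.norm_le _ (norm_nonneg _)).2 fun x => ?_
      simp [norm_circleChar]) hd.norm)
  simp only [ContinuousMap.coe_mk, intervalIntegral.integral_const_mul, integral_circleChar,
    sub_eq_zero, mul_ite, mul_one, mul_zero] at this
  rw [this.tsum_eq]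
  refine intervalIntegral.integral_congr fun x _ => ?_
  simp only [sub_eq_add_neg, circleChar_add, ← mul_assoc, tsum_mul_right]

/-- A family of functions of absolute value one is separating if absolutely convergent expansions
in terms of this family are unique. -/
def IsSeparating {X κ : Type*} (χ : X → κ → ℂ) : Prop :=
  (∀ x i, ‖χ x i‖ = 1) ∧ ∀ d d' : κ → ℂ, Summable d → Summable d' →
    (∀ x, ∑' i, d i * χ x i = ∑' i, d' i * χ x i) → d = d'

lemma isSeparating_circleChar : IsSeparating fun x n => circleChar n x := by
  refine ⟨fun x n => norm_circleChar n x, fun d d' hd hd' h => funext fun m => ?_⟩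
  have h1 := tsum_ite_eq_integral hd id m
  have h2 := tsum_ite_eq_integral hd' id m
  simp only [id_eq, h, tsum_ite_eq] at h1 h2
  rw [h1, h2]

lemma tsum_eq_of_circleChar {κ : Type*} [Countable κ] {d d' : ℤ × κ → ℂ} (hd : Summable d)
    (hd' : Summable d')
    (h : ∀ x, ∑' i, d i * circleChar i.1 x = ∑' i, d' i * circleChar i.1 x) (m : ℤ) :
    ∑' k, d (m, k) = ∑' k, d' (m, k) := by
  have hfib (d : ℤ × κ → ℂ) : ∑' k, d (m, k) = ∑' i, if i.1 = m then d i else 0 := by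
    have hinj : Function.Injective fun k : κ => (m, k) := fun a b hab => (Prod.ext_iff.1 hab).2
    rw [← hinj.tsum_eq]
    · simp
    · intro i hi
      have : i.1 = m := by
        by_contra h
        simp [h] at hi
      exact ⟨i.2, Prod.ext this.symm rfl⟩
  rw [hfib, hfib, tsum_ite_eq_integral hd, tsum_ite_eq_integral hd']
  simp only [h]

lemma IsSeparating.prod {X κ : Type*} [Countable κ] {χ : X → κ → ℂ} (hχ : IsSeparating χ) :
    IsSeparating fun (x : ℝ × X) (i : ℤ × κ) => circleChar i.1 x.1 * χ x.2 i.2 := by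
  refine ⟨fun x i => by rw [norm_mul, norm_circleChar, hχ.1, one_mul], fun d d' hd hd' h => ?_⟩
  have hsum {d : ℤ × κ → ℂ} (hd : Summable d) (x : X) : Summable fun i => d i * χ x i.2 :=
    hd.norm.of_norm_bounded fun i => by rw [norm_mul, hχ.1, mul_one]
  have hinj (m : ℤ) : Function.Injective fun k : κ => (m, k) :=
    fun a b hab => (Prod.ext_iff.1 hab).2
  funext ⟨m, k⟩
  refine congrFun (hχ.2 (fun k => d (m, k)) (fun k => d' (m, k)) (hd.comp_injective (hinj m))
    (hd'.comp_injective (hinj m)) fun x => ?_) k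
  refine tsum_eq_of_circleChar (hsum hd x) (hsum hd' x) (fun y => ?_) m
  convert! h (y, x) using 3 <;> ring

end FourierUniqueness

section FourierCoordinates

open Real

lemma sqrtD_neg_four : sqrtD (-4) = 2 * Complex.I := by
  rw [sqrtD, show (-((-4 : ℤ) : ℝ)) = 2 ^ 2 by norm_num, Real.sqrt_sq (by norm_num)]
  norm_num

lemma mem_ringInt_neg_four {z : ℂ} : z ∈ ringInt (-4) ↔ ∃ a b : ℤ, z = a + b * Complex.I := by
  rw [ringInt, Set.mem_ofPred_eq, sqrtD_neg_four]
  constructor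
  · rintro ⟨a, b, rfl⟩
    exact ⟨a - 2 * b, b, by push_cast; ring⟩
  · rintro ⟨a, b, rfl⟩
    exact ⟨a + 2 * b, b, by push_cast; ring⟩

lemma mem_invDiff_neg_four {z : ℂ} :
    z ∈ invDiff (-4) ↔ ∃ r s : ℤ, z = (r + s * Complex.I) / 2 := by
  rw [invDiff, Set.mem_ofPred_eq, mem_ringInt_neg_four, sqrtD_neg_four]
  constructor
  · rintro ⟨a, b, h⟩
    refine ⟨b, -a, mul_left_cancel₀ (mul_ne_zero two_ne_zero I_ne_zero) (h.trans ?_)⟩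
    push_cast
    linear_combination (a : ℂ) * Complex.I_mul_I
  · rintro ⟨r, s, rfl⟩
    refine ⟨-s, r, ?_⟩
    push_cast
    linear_combination (s : ℂ) * Complex.I_mul_I

/-- The Hermitian matrix with diagonal `m, n` and off-diagonal entry `(r + si) / 2`. -/
def hermIndex (p : ℤ × ℤ × ℤ × ℤ) : Matrix (Fin 2) (Fin 2) ℂ :=
  !![(p.1 : ℂ), (p.2.2.1 + p.2.2.2 * Complex.I) / 2;
    (starRingEnd ℂ) ((p.2.2.1 + p.2.2.2 * Complex.I) / 2), (p.2.1 : ℂ)]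

lemma hermIndex_injective : Function.Injective hermIndex := by
  rintro ⟨m, n, r, s⟩ ⟨m', n', r', s'⟩ h
  have h00 := congrFun (congrFun h 0) 0
  have h11 := congrFun (congrFun h 1) 1
  have h01 := congrFun (congrFun h 0) 1
  have hre := congrArg Complex.re h01
  have him := congrArg Complex.im h01
  simp [hermIndex] at h00 h11 hre him
  simp_all

lemma exists_hermIndex_eq {H : Matrix (Fin 2) (Fin 2) ℂ} (hH : H ∈ LambdaH (-4)) :
    ∃ p, hermIndex p = H := by
  obtain ⟨h1, h2, h3⟩ := hH
  obtain ⟨m, hm⟩ := h2 0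
  obtain ⟨n, hn⟩ := h2 1
  obtain ⟨r, s, hrs⟩ := mem_invDiff_neg_four.1 (h3 0 1)
  refine ⟨(m, n, r, s), ?_⟩
  ext i j
  fin_cases i <;> fin_cases j
  · exact hm.symm
  · exact hrs.symm
  · change (starRingEnd ℂ) _ = _
    rw [← hrs]
    exact h1.apply 1 0
  · exact hn.symm

lemma hermIndex_posSemidef {p : ℤ × ℤ × ℤ × ℤ} (h : (hermIndex p).PosSemidef) :
    0 ≤ p.1 ∧ 0 ≤ p.2.1 ∧ p.2.2.1 ^ 2 + p.2.2.2 ^ 2 ≤ 4 * p.1 * p.2.1 := by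
  have h0 : (0 : ℂ) ≤ (p.1 : ℝ) := by simpa [hermIndex] using h.diag_nonneg (i := 0)
  have h1 : (0 : ℂ) ≤ (p.2.1 : ℝ) := by simpa [hermIndex] using h.diag_nonneg (i := 1)
  have h2 := h.det_nonneg
  rw [Complex.zero_le_real] at h0 h1
  refine ⟨by exact_mod_cast h0, by exact_mod_cast h1, ?_⟩
  rw [hermIndex, Matrix.det_fin_two_of, mul_conj, ← ofReal_intCast, ← ofReal_intCast,
    ← ofReal_mul, ← ofReal_sub, Complex.zero_le_real] at h2
  simp [normSq_apply] at h2
  have : (p.2.2.1 ^ 2 + p.2.2.2 ^ 2 : ℝ) ≤ 4 * p.1 * p.2.1 := by linarith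
  exact_mod_cast this

/-- The matrix with diagonal `t, τ` and off-diagonal entries `u ± iv`. -/
def hermPoint (z : ℂ × ℂ × ℂ × ℂ) : Matrix (Fin 2) (Fin 2) ℂ :=
  !![z.1, z.2.2.1 + z.2.2.2 * Complex.I; z.2.2.1 - z.2.2.2 * Complex.I, z.2.1]

/-- The coordinates of the Hermitian upper half-space. -/
def tube : Set (ℂ × ℂ × ℂ × ℂ) :=
  {z | 0 < z.1.im ∧ z.2.2.1.im ^ 2 + z.2.2.2.im ^ 2 < z.1.im * z.2.1.im}

lemma posDef_of_pos_of_det_pos {a b x y : ℝ} (ha : 0 < a) (h : x ^ 2 + y ^ 2 < a * b) :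
    (!![(a : ℂ), x + y * Complex.I; x - y * Complex.I, b]).PosDef := by
  refine Matrix.PosDef.of_dotProduct_mulVec_pos ?_ fun w hw => ?_
  · ext i j
    fin_cases i <;> fin_cases j <;> simp [Matrix.conjTranspose_apply, sub_eq_add_neg]
  · set p := w 0
    set q := w 1
    have hform : star w ⬝ᵥ (!![(a : ℂ), x + y * Complex.I; x - y * Complex.I, b] *ᵥ w) =
        ((a * normSq p + b * normSq q + 2 * (x * (p.re * q.re + p.im * q.im) +
          y * (p.im * q.re - p.re * q.im)) : ℝ) : ℂ) := by
      apply Complex.ext <;>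
        simp [dotProduct, Matrix.mulVec, Fin.sum_univ_two, normSq_apply, p, q] <;> ring
    rw [hform, Complex.zero_lt_real]
    refine (mul_pos_iff_of_pos_left ha).1 ?_
    have hsq : a * (a * normSq p + b * normSq q + 2 * (x * (p.re * q.re + p.im * q.im) +
        y * (p.im * q.re - p.re * q.im))) = normSq (a * p + (x + y * Complex.I) * q) +
        (a * b - (x ^ 2 + y ^ 2)) * normSq q := by
      simp [normSq_apply]
      ring
    rw [hsq]
    rcases eq_or_ne q 0 with hq | hq
    · have hp : p ≠ 0 := fun hp => hw (funext fun i => by fin_cases i <;> assumption)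
      simpa [hq] using mul_pos (mul_pos ha ha) (normSq_pos.2 hp)
    · exact add_pos_of_nonneg_of_pos (normSq_nonneg _)
        (mul_pos (sub_pos.2 h) (normSq_pos.2 hq))

lemma hermPoint_mem {z : ℂ × ℂ × ℂ × ℂ} (hz : z ∈ tube) :
    hermPoint z ∈ HermitianUpperHalfSpace := by
  rw [HermitianUpperHalfSpace, Set.mem_ofPred_eq]
  convert! posDef_of_pos_of_det_pos hz.1 hz.2 using 1
  ext i j
  fin_cases i <;> fin_cases j <;> simp [hermPoint, Matrix.conjTranspose_apply] <;>
    simp [Complex.ext_iff, div_im, div_re] <;> (try refine ⟨?_, ?_⟩) <;> ring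

/-- The exponential `exp (2πi tr(HZ))` in coordinates. -/
def hermExp (p : ℤ × ℤ × ℤ × ℤ) (z : ℂ × ℂ × ℂ × ℂ) : ℂ :=
  cexp (2 * π * Complex.I * (p.1 * z.1 + (p.2.1 * z.2.1 + (p.2.2.1 * z.2.2.1 +
    p.2.2.2 * z.2.2.2))))

lemma hermIndex_mul_hermPoint_trace (p : ℤ × ℤ × ℤ × ℤ) (z : ℂ × ℂ × ℂ × ℂ) :
    (hermIndex p * hermPoint z).trace = p.1 * z.1 + (p.2.1 * z.2.1 + (p.2.2.1 * z.2.2.1 +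
      p.2.2.2 * z.2.2.2)) := by
  simp [hermIndex, hermPoint, Matrix.trace_fin_two, Complex.conj_ofNat]
  linear_combination (-(p.2.2.2 : ℂ) * z.2.2.2) * Complex.I_mul_I

end FourierCoordinates

section FourierSymmetries

open Real

lemma isSeparating_torusChar : IsSeparating fun (x : ℝ × ℝ × ℝ × ℝ) (p : ℤ × ℤ × ℤ × ℤ) =>
    circleChar p.1 x.1 * (circleChar p.2.1 x.2.1 * (circleChar p.2.2.1 x.2.2.1 *
      circleChar p.2.2.2 x.2.2.2)) :=
  isSeparating_circleChar.prod.prod.prod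

/-- Translation by a real vector. -/
def realShift (z : ℂ × ℂ × ℂ × ℂ) (x : ℝ × ℝ × ℝ × ℝ) : ℂ × ℂ × ℂ × ℂ :=
  (z.1 + x.1, z.2.1 + x.2.1, z.2.2.1 + x.2.2.1, z.2.2.2 + x.2.2.2)

lemma hermExp_realShift (p : ℤ × ℤ × ℤ × ℤ) (z : ℂ × ℂ × ℂ × ℂ) (x : ℝ × ℝ × ℝ × ℝ) :
    hermExp p (realShift z x) = hermExp p z * (circleChar p.1 x.1 * (circleChar p.2.1 x.2.1 *
      (circleChar p.2.2.1 x.2.2.1 * circleChar p.2.2.2 x.2.2.2))) := by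
  simp only [hermExp, circleChar, realShift, ← Complex.exp_add]
  ring_nf

lemma ringInt_zero_mem : (0 : ℂ) ∈ ringInt (-4) := ⟨0, 0, by simp⟩

lemma ringInt_one_mem : (1 : ℂ) ∈ ringInt (-4) := ⟨1, 0, by simp⟩

lemma ringInt_I_mem : Complex.I ∈ ringInt (-4) := mem_ringInt_neg_four.2 ⟨0, 1, by simp⟩

lemma ringInt_neg_mem {z : ℂ} (hz : z ∈ ringInt (-4)) : -z ∈ ringInt (-4) := by
  obtain ⟨a, b, rfl⟩ := hz
  exact ⟨-a, -b, by push_cast; ring⟩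

lemma ringInt_conj_mem {z : ℂ} (hz : z ∈ ringInt (-4)) : (starRingEnd ℂ) z ∈ ringInt (-4) := by
  obtain ⟨a, b, rfl⟩ := mem_ringInt_neg_four.1 hz
  exact mem_ringInt_neg_four.2 ⟨a, -b, by simp⟩

lemma conjTranspose_fin_two (a b c d : ℂ) :
    !![a, b; c, d]ᴴ = !![(starRingEnd ℂ) a, (starRingEnd ℂ) c; (starRingEnd ℂ) b,
      (starRingEnd ℂ) d] := by
  ext i j
  fin_cases i <;> fin_cases j <;> rfl

lemma hermExp_ne_zero (p : ℤ × ℤ × ℤ × ℤ) (z : ℂ × ℂ × ℂ × ℂ) : hermExp p z ≠ 0 := exp_ne_zero _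

namespace HermitianModularForm

variable {k : ℤ}

/-- The Fourier coefficients in coordinates. -/
def fourier (f : HermitianModularForm (-4) k) (p : ℤ × ℤ × ℤ × ℤ) : ℂ := f.coeff (hermIndex p)

lemma fourier_ne_zero (f : HermitianModularForm (-4) k) {p : ℤ × ℤ × ℤ × ℤ}
    (hp : f.fourier p ≠ 0) :
    0 ≤ p.1 ∧ 0 ≤ p.2.1 ∧ p.2.2.1 ^ 2 + p.2.2.2 ^ 2 ≤ 4 * p.1 * p.2.1 :=
  hermIndex_posSemidef (f.coeff_supported _ hp).2

lemma hasSum_fourier (f : HermitianModularForm (-4) k) {z : ℂ × ℂ × ℂ × ℂ} (hz : z ∈ tube) :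
    HasSum (fun p => f.fourier p * hermExp p z) (f.toFun (hermPoint z)) := by
  have h := f.expansion _ (hermPoint_mem hz)
  have h0 (H : Matrix (Fin 2) (Fin 2) ℂ) (hH : H ∉ HermLattice (-4)) : f.coeff H = 0 :=
    not_not.1 fun h => hH (f.coeff_supported H h)
  replace h := (hasSum_subtype_iff_of_support_subset (f := fun H : Matrix (Fin 2) (Fin 2) ℂ =>
    f.coeff H * cexp (2 * π * Complex.I * (H * hermPoint z).trace)) (fun H hH =>
      f.coeff_supported H (left_ne_zero_of_mul hH))).1 h
  rw [← hermIndex_injective.hasSum_iff fun H hH => by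
    rw [h0 H fun hH' => hH (exists_hermIndex_eq hH'.1), zero_mul]] at h
  simpa only [Function.comp_def, hermIndex_mul_hermPoint_trace, fourier, hermExp] using h

lemma fourier_eq_of_invariant (f : HermitianModularForm (-4) k)
    (σ : (ℤ × ℤ × ℤ × ℤ) ≃ (ℤ × ℤ × ℤ × ℤ)) {g : ℂ × ℂ × ℂ × ℂ → ℂ × ℂ × ℂ × ℂ}
    (hg : ∀ p z, hermExp p (g z) = hermExp (σ p) z)
    (hf : ∀ z ∈ tube, f.toFun (hermPoint (g z)) = f.toFun (hermPoint z))
    (hmem : ∀ x, g (realShift (Complex.I, Complex.I, 0, 0) x) ∈ tube) (p : ℤ × ℤ × ℤ × ℤ) :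
    f.fourier (σ p) = f.fourier p := by
  set z₀ : ℂ × ℂ × ℂ × ℂ := (Complex.I, Complex.I, 0, 0)
  have hz (x : ℝ × ℝ × ℝ × ℝ) : realShift z₀ x ∈ tube := by
    simp [tube, realShift, z₀]
  have h1 (x : ℝ × ℝ × ℝ × ℝ) := f.hasSum_fourier (hz x)
  have h2 (x : ℝ × ℝ × ℝ × ℝ) : HasSum (fun p => f.fourier (σ.symm p) * hermExp p (realShift z₀ x))
      (f.toFun (hermPoint (realShift z₀ x))) := by
    have := f.hasSum_fourier (hmem x)
    rw [hf _ (hz x), ← σ.symm.hasSum_iff] at this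
    simpa only [Function.comp_def, hg, σ.apply_symm_apply] using this
  have h0 : realShift z₀ (0, 0, 0, 0) = z₀ := by simp [realShift]
  have key := isSeparating_torusChar.2 _ _ (h0 ▸ (h1 (0, 0, 0, 0)).summable)
    (h0 ▸ (h2 (0, 0, 0, 0)).summable) fun x => by
      simp only [mul_assoc, ← hermExp_realShift]
      exact (h1 x).tsum_eq.trans (h2 x).tsum_eq.symm
  have := mul_right_cancel₀ (hermExp_ne_zero _ _) (congrFun key (σ p))
  rwa [σ.symm_apply_apply] at this

lemma toFun_conj (f : HermitianModularForm (-4) k) (hk : Even k) {a b c d : ℂ}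
    {Z : Matrix (Fin 2) (Fin 2) ℂ} (ha : a ∈ ringInt (-4)) (hb : b ∈ ringInt (-4))
    (hc : c ∈ ringInt (-4)) (hd : d ∈ ringInt (-4)) (hdet : a * d - b * c = 1 ∨ a * d - b * c = -1)
    (hZ : Z ∈ HermitianUpperHalfSpace) :
    f.toFun (!![a, b; c, d] * Z * !![a, b; c, d]ᴴ) = f.toFun Z := by
  set ε := a * d - b * c with hε
  set U := !![a, b; c, d] with hU
  set V := ε • !![(starRingEnd ℂ) d, -(starRingEnd ℂ) c; -(starRingEnd ℂ) b, (starRingEnd ℂ) a]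
    with hV
  have hεε : ε * ε = 1 := by rcases hdet with h | h <;> simp [h]
  have hconj : (starRingEnd ℂ) ε = ε := by rcases hdet with h | h <;> simp [h]
  have h : Uᴴ * V = 1 := by
    rw [hU, hV, conjTranspose_fin_two, Matrix.mul_smul, Matrix.mul_fin_two]
    rw [hε, map_sub, map_mul, map_mul, ← hε] at hconj
    ext i j
    fin_cases i <;> fin_cases j <;> simp
    · linear_combination ε * hconj + hεε
    · exact Or.inr (by ring)
    · exact Or.inr (by ring)
    · linear_combination ε * hconj + hεε
  have hmem : ∀ z ∈ ringInt (-4), ε * z ∈ ringInt (-4) := fun z hz => by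
    rcases hdet with h | h <;> simp [h, hz, ringInt_neg_mem]
  have hdetV : V.det = ε := by
    rw [hV, Matrix.det_smul, Matrix.det_fin_two_of, Fintype.card_fin, sq, hεε]
    rw [hε, map_sub, map_mul, map_mul] at hconj
    linear_combination hconj
  have h' : Vᴴ * U = 1 := by simpa using congrArg conjTranspose h
  have := f.transform (Matrix.fromBlocks U 0 0 V) ⟨?_, ?_⟩ Z hZ
  · have hdetU : U.det = ε := Matrix.det_fin_two_of _ _ _ _
    have hεk : ε ^ k = 1 := by rcases hdet with h | h <;> simp [h, hk.neg_one_zpow]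
    simpa [matAct, nuChar, hdetV, hdetU, hεε, hεk, Matrix.inv_eq_left_inv h] using this
  · rintro (i | i) (j | j)
    · fin_cases i <;> fin_cases j <;> assumption
    · exact ringInt_zero_mem
    · exact ringInt_zero_mem
    · fin_cases i <;> fin_cases j <;>
        exact hmem _ (by simp [ringInt_conj_mem, ringInt_neg_mem, ha, hb, hc, hd])
  · simp [J2, Matrix.fromBlocks_conjTranspose, Matrix.fromBlocks_multiply, h, h']

lemma fourier_neg_right (f : HermitianModularForm (-4) k) (hf : IsSymmetricHMF f)
    (m n r s : ℤ) : f.fourier (m, n, r, -s) = f.fourier (m, n, r, s) := by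
  refine f.fourier_eq_of_invariant
    (((Equiv.refl ℤ).prodCongr ((Equiv.refl ℤ).prodCongr ((Equiv.refl ℤ).prodCongr
      (Equiv.neg ℤ)))))
    (g := fun z => (z.1, z.2.1, z.2.2.1, -z.2.2.2)) (fun p z => ?_) (fun z hz => ?_) (fun x => ?_)
    (m, n, r, s)
  · simp [hermExp]
  · rw [← hf _ (hermPoint_mem hz)]
    congr 1
    ext i j
    fin_cases i <;> fin_cases j <;> simp [hermPoint, sub_eq_add_neg]
  · simp [tube, realShift]

lemma fourier_swap (f : HermitianModularForm (-4) k) (hk : Even k) (m n r s : ℤ) :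
    f.fourier (n, m, r, -s) = f.fourier (m, n, r, s) := by
  refine f.fourier_eq_of_invariant
    ⟨fun p => (p.2.1, p.1, p.2.2.1, -p.2.2.2), fun p => (p.2.1, p.1, p.2.2.1, -p.2.2.2),
      fun p => by simp, fun p => by simp⟩
    (g := fun z => (z.2.1, z.1, z.2.2.1, -z.2.2.2)) (fun p z => ?_) (fun z hz => ?_) (fun x => ?_)
    (m, n, r, s)
  · simp only [hermExp, Equiv.coe_fn_mk]
    push_cast
    ring_nf
  · rw [← f.toFun_conj hk ringInt_zero_mem ringInt_one_mem
      ringInt_one_mem ringInt_zero_mem (by simp) (hermPoint_mem hz), conjTranspose_fin_two]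
    congr 1
    ext i j
    fin_cases i <;> fin_cases j <;> simp [hermPoint]
    all_goals ring
  · simp [tube, realShift]

lemma fourier_neg_neg (f : HermitianModularForm (-4) k) (hk : Even k) (m n r s : ℤ) :
    f.fourier (m, n, -r, -s) = f.fourier (m, n, r, s) := by
  refine f.fourier_eq_of_invariant
    ⟨fun p => (p.1, p.2.1, -p.2.2.1, -p.2.2.2), fun p => (p.1, p.2.1, -p.2.2.1, -p.2.2.2),
      fun p => by simp, fun p => by simp⟩
    (g := fun z => (z.1, z.2.1, -z.2.2.1, -z.2.2.2)) (fun p z => ?_) (fun z hz => ?_) (fun x => ?_)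
    (m, n, r, s)
  · simp [hermExp]
  · rw [← f.toFun_conj hk ringInt_one_mem ringInt_zero_mem
      ringInt_zero_mem (ringInt_neg_mem ringInt_one_mem) (by simp) (hermPoint_mem hz),
      conjTranspose_fin_two]
    congr 1
    ext i j
    fin_cases i <;> fin_cases j <;> simp [hermPoint]
    all_goals ring
  · simp [tube, realShift]

lemma fourier_shear_left (f : HermitianModularForm (-4) k) (hk : Even k) (m n r s : ℤ) :
    f.fourier (m, n + r + m, r + 2 * m, s) = f.fourier (m, n, r, s) := by
  refine f.fourier_eq_of_invariant
    ⟨fun p => (p.1, p.2.1 + p.2.2.1 + p.1, p.2.2.1 + 2 * p.1, p.2.2.2),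
      fun p => (p.1, p.2.1 - p.2.2.1 + p.1, p.2.2.1 - 2 * p.1, p.2.2.2),
      fun p => by ext <;> dsimp only <;> ring, fun p => by ext <;> dsimp only <;> ring⟩
    (g := fun z => (z.1 + z.2.1 + 2 * z.2.2.1, z.2.1, z.2.2.1 + z.2.1, z.2.2.2))
    (fun p z => ?_) (fun z hz => ?_) (fun x => ?_) (m, n, r, s)
  · simp only [hermExp, Equiv.coe_fn_mk]
    push_cast
    ring_nf
  · rw [← f.toFun_conj hk ringInt_one_mem ringInt_one_mem
      ringInt_zero_mem ringInt_one_mem (by simp) (hermPoint_mem hz), conjTranspose_fin_two]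
    congr 1
    ext i j
    fin_cases i <;> fin_cases j <;> simp [hermPoint]
    all_goals ring
  · simp [tube, realShift]

lemma fourier_shear_right (f : HermitianModularForm (-4) k) (hk : Even k) (m n r s : ℤ) :
    f.fourier (m, n + s + m, r, s + 2 * m) = f.fourier (m, n, r, s) := by
  refine f.fourier_eq_of_invariant
    ⟨fun p => (p.1, p.2.1 + p.2.2.2 + p.1, p.2.2.1, p.2.2.2 + 2 * p.1),
      fun p => (p.1, p.2.1 - p.2.2.2 + p.1, p.2.2.1, p.2.2.2 - 2 * p.1),
      fun p => by ext <;> dsimp only <;> ring, fun p => by ext <;> dsimp only <;> ring⟩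
    (g := fun z => (z.1 + z.2.1 + 2 * z.2.2.2, z.2.1, z.2.2.1, z.2.2.2 + z.2.1))
    (fun p z => ?_) (fun z hz => ?_) (fun x => ?_) (m, n, r, s)
  · simp only [hermExp, Equiv.coe_fn_mk]
    push_cast
    ring_nf
  · rw [← f.toFun_conj hk ringInt_one_mem ringInt_I_mem
      ringInt_zero_mem ringInt_one_mem (by simp) (hermPoint_mem hz), conjTranspose_fin_two]
    congr 1
    ext i j
    fin_cases i <;> fin_cases j <;> simp [hermPoint]
    · linear_combination (z.2.1 + 2 * z.2.2.2) * Complex.I_mul_I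
    all_goals ring
  · simp [tube, realShift]

end HermitianModularForm

end FourierSymmetries

section FourierJacobiExpansion

open Real UpperHalfPlane

/-- The embedded inversion of the last coordinate. -/
def inversionMatrix : Matrix (Fin 2 ⊕ Fin 2) (Fin 2 ⊕ Fin 2) ℂ :=
  Matrix.fromBlocks !![1, 0; 0, 0] !![0, 0; 0, -1] !![0, 0; 0, 1] !![1, 0; 0, 0]

lemma det_inversionMatrix : inversionMatrix.det = 1 := by
  have h : inversionMatrix = Matrix.fromBlocks 1 !![0, 0; 0, -1] 0 1 *
      Matrix.fromBlocks 1 0 !![0, 0; 0, 1] 1 * Matrix.fromBlocks 1 !![0, 0; 0, -1] 0 1 := by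
    simp [inversionMatrix, Matrix.fromBlocks_multiply, Matrix.one_fin_two]
  rw [h, Matrix.det_mul, Matrix.det_mul, Matrix.det_fromBlocks_zero₂₁,
    Matrix.det_fromBlocks_zero₁₂]
  simp

lemma inversionMatrix_mem : inversionMatrix ∈ HermitianModularGroup (-4) := by
  refine ⟨?_, ?_⟩
  · rintro (i | i) (j | j) <;> fin_cases i <;> fin_cases j <;>
      simp [inversionMatrix, ringInt_zero_mem, ringInt_one_mem, ringInt_neg_mem]
  · simp [inversionMatrix, J2, Matrix.fromBlocks_conjTranspose, Matrix.fromBlocks_multiply,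
      conjTranspose_fin_two, Matrix.one_fin_two]
    ext i j
    fin_cases i <;> fin_cases j <;> rfl

lemma exists_mem_tube (τ : ℍ) (u v : ℂ) :
    ∃ T : ℝ, ∀ t : ℂ, T < t.im → (t, (τ : ℂ), u, v) ∈ tube := by
  have hτ := τ.im_pos
  refine ⟨(u.im ^ 2 + v.im ^ 2) / τ.im, fun t ht => ⟨lt_of_le_of_lt (by positivity) ht, ?_⟩⟩
  exact (div_lt_iff₀ hτ).1 ht

namespace HermitianModularForm

variable {k : ℤ}

lemma toFun_inversion (f : HermitianModularForm (-4) k) {t u v : ℂ} {τ : ℍ}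
    (hz : (t, (τ : ℂ), u, v) ∈ tube) :
    f.toFun (hermPoint (t - (u ^ 2 + v ^ 2) * (τ : ℂ)⁻¹, (-(τ : ℂ))⁻¹, (τ : ℂ)⁻¹ * u,
      (τ : ℂ)⁻¹ * v)) = (τ : ℂ) ^ k * f.toFun (hermPoint (t, (τ : ℂ), u, v)) := by
  have hτ : (τ : ℂ) ≠ 0 := τ.ne_zero
  have h := f.transform _ inversionMatrix_mem _ (hermPoint_mem hz)
  set Z := hermPoint (t, (τ : ℂ), u, v) with hZ
  have hCD : inversionMatrix.toBlocks₂₁ * Z + inversionMatrix.toBlocks₂₂ =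
      !![1, 0; u - v * Complex.I, (τ : ℂ)] := by
    simp [inversionMatrix, hZ, hermPoint]
  have hinv : !![1, 0; u - v * Complex.I, (τ : ℂ)]⁻¹ =
      !![1, 0; -(τ : ℂ)⁻¹ * (u - v * Complex.I), (τ : ℂ)⁻¹] := by
    refine Matrix.inv_eq_left_inv ?_
    simp [Matrix.one_fin_two, hτ]
  rw [matAct, hCD, hinv, nuChar, if_pos rfl, det_inversionMatrix, _root_.one_zpow, one_mul,
    Matrix.det_fin_two_of] at h
  convert! h using 2
  · ext i j
    fin_cases i <;> fin_cases j <;> simp [inversionMatrix, hZ, hermPoint]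
    · linear_combination -(τ : ℂ)⁻¹ * v ^ 2 * Complex.I_mul_I
    · ring
    · ring
  · simp

/-- The Fourier coefficients of the Fourier–Jacobi coefficient of index `m`. -/
def jacobi (f : HermitianModularForm (-4) k) (m : ℕ) (q : ℤ × ℤ × ℤ) : ℂ := f.fourier (m, q)

/-- The terms of the Fourier–Jacobi coefficient of index `m`. -/
def jacobiTerm (f : HermitianModularForm (-4) k) (m : ℕ) (τ : ℍ) (x y : ℂ) (q : ℤ × ℤ × ℤ) : ℂ :=
  f.jacobi m q * nome τ ^ q.1.toNat * cexp (q.2.1 * x + q.2.2 * y)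

lemma fourier_mul_hermExp (f : HermitianModularForm (-4) k) (m : ℕ) (τ : ℍ) (x y t : ℂ)
    (q : ℤ × ℤ × ℤ) :
    f.fourier (m, q) * hermExp (m, q) (t, (τ : ℂ), (2 * π * Complex.I)⁻¹ * x,
      (2 * π * Complex.I)⁻¹ * y) = cexp (2 * π * Complex.I * (m * t)) * f.jacobiTerm m τ x y q := by
  by_cases h : f.fourier (m, q) = 0
  · simp [jacobiTerm, jacobi, h]
  · have hq := (f.fourier_ne_zero h).2.1
    have hn : nome τ ^ q.1.toNat = cexp (2 * π * Complex.I * (q.1 * τ)) := by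
      rw [nome_eq, ← Complex.exp_nat_mul]
      congr 1
      have : ((q.1.toNat : ℤ) : ℂ) = q.1 := by rw [Int.toNat_of_nonneg hq]
      rw [Int.cast_natCast] at this
      rw [this]
      ring
    have hpi := two_pi_I_ne_zero
    rw [jacobiTerm, jacobi, hn, hermExp, mul_assoc (f.fourier _), mul_left_comm (cexp _),
      ← Complex.exp_add, ← Complex.exp_add]
    congr 2
    push_cast
    field_simp

lemma summable_jacobiTerm (f : HermitianModularForm (-4) k) (m : ℕ) (τ : ℍ) (x y : ℂ) :
    Summable (f.jacobiTerm m τ x y) := by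
  obtain ⟨T, hT⟩ := exists_mem_tube τ ((2 * π * Complex.I)⁻¹ * x) ((2 * π * Complex.I)⁻¹ * y)
  have h := (f.hasSum_fourier (hT ((T + 1 : ℝ) * Complex.I) (by simp))).summable.comp_injective
    (i := fun q => ((m : ℤ), q)) fun a b hab => (Prod.ext_iff.1 hab).2
  simp only [Function.comp_def, fourier_mul_hermExp] at h
  exact (summable_mul_left_iff (Complex.exp_ne_zero _)).1 h

lemma jacobi_neg_right (f : HermitianModularForm (-4) k) (hf : IsSymmetricHMF f) (m : ℕ)
    (n r s : ℤ) : f.jacobi m (n, r, -s) = f.jacobi m (n, r, s) :=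
  f.fourier_neg_right hf _ _ _ _

lemma jacobi_neg_left (f : HermitianModularForm (-4) k) (hk : Even k) (hf : IsSymmetricHMF f)
    (m : ℕ) (n r s : ℤ) : f.jacobi m (n, -r, s) = f.jacobi m (n, r, s) :=
  (f.fourier_neg_right hf _ _ _ _).symm.trans (f.fourier_neg_neg hk _ _ _ _)

lemma tsum_jacobiTerm_neg_right (f : HermitianModularForm (-4) k) (hf : IsSymmetricHMF f)
    (m : ℕ) (τ : ℍ) (x y : ℂ) :
    ∑' q, f.jacobiTerm m τ x (-y) q = ∑' q, f.jacobiTerm m τ x y q := by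
  rw [← ((Equiv.refl ℤ).prodCongr ((Equiv.refl ℤ).prodCongr (Equiv.neg ℤ))).tsum_eq
    (f.jacobiTerm m τ x y)]
  refine tsum_congr fun ⟨n, r, s⟩ => ?_
  simp [jacobiTerm, f.jacobi_neg_right hf]

lemma tsum_jacobiTerm_neg_left (f : HermitianModularForm (-4) k) (hk : Even k)
    (hf : IsSymmetricHMF f) (m : ℕ) (τ : ℍ) (x y : ℂ) :
    ∑' q, f.jacobiTerm m τ (-x) y q = ∑' q, f.jacobiTerm m τ x y q := by
  rw [← ((Equiv.refl ℤ).prodCongr ((Equiv.neg ℤ).prodCongr (Equiv.refl ℤ))).tsum_eq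
    (f.jacobiTerm m τ x y)]
  refine tsum_congr fun ⟨n, r, s⟩ => ?_
  simp [jacobiTerm, f.jacobi_neg_left hk hf]

lemma fourierJacobi_jacobi (f : HermitianModularForm (-4) k) (hk : Even k) (hf : IsSymmetricHMF f)
    (m : ℕ) (τ : ℍ) (x y : ℂ) :
    fourierJacobi (f.jacobi m) τ x y = ∑' q, f.jacobiTerm m τ x y q := by
  have h (q : ℤ × ℤ × ℤ) : f.jacobi m q * nome τ ^ q.1.toNat *
      (Complex.cosh (q.2.1 * x) * Complex.cosh (q.2.2 * y)) =
      4⁻¹ * ((f.jacobiTerm m τ x y q + f.jacobiTerm m τ x (-y) q) +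
        (f.jacobiTerm m τ (-x) y q + f.jacobiTerm m τ (-x) (-y) q)) := by
    simp only [jacobiTerm, Complex.cosh, Complex.exp_add, mul_neg]
    ring
  have hs := f.summable_jacobiTerm m τ
  rw [fourierJacobi, tsum_congr h, tsum_mul_left,
    ((hs _ _).add (hs _ _)).tsum_add ((hs _ _).add (hs _ _)), (hs _ _).tsum_add (hs _ _),
    (hs _ _).tsum_add (hs _ _), f.tsum_jacobiTerm_neg_left hk hf, f.tsum_jacobiTerm_neg_left hk hf,
    f.tsum_jacobiTerm_neg_right hf]
  ring

lemma rapid_jacobi (f : HermitianModularForm (-4) k) (m : ℕ) {q : ℂ} (hq : ‖q‖ < 1) (R : ℝ) :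
    Summable fun p : ℤ × ℤ × ℤ => ‖f.jacobi m p * q ^ p.1.toNat‖ *
      Real.exp (R * (|(p.2.1 : ℝ)| + |(p.2.2 : ℝ)|)) := by
  obtain ⟨τ, hτ⟩ : ∃ τ : ℍ, ‖q‖ ≤ ‖nome τ‖ := by
    rcases eq_or_ne q 0 with rfl | h
    · exact ⟨UpperHalfPlane.I, by simp⟩
    · obtain ⟨τ, hτ⟩ := exists_nome_eq hq h
      exact ⟨τ, by rw [hτ]⟩
  have hs (x y : ℝ) := (f.summable_jacobiTerm m τ x y).norm
  refine Summable.of_nonneg_of_le (fun _ => by positivity) (fun p => ?_)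
    (((hs R R).add (hs R (-R))).add ((hs (-R) R).add (hs (-R) (-R))))
  have hterm (x y : ℝ) : ‖f.jacobiTerm m τ x y p‖ =
      ‖f.jacobi m p * nome τ ^ p.1.toNat‖ * Real.exp (p.2.1 * x + p.2.2 * y) := by
    rw [jacobiTerm, norm_mul, Complex.norm_exp]
    simp
  rw [hterm, hterm, hterm, hterm, ← mul_add, ← mul_add, ← mul_add]
  refine mul_le_mul ?_ ?_ (Real.exp_pos _).le (norm_nonneg _)
  · rw [norm_mul, norm_mul, norm_pow, norm_pow]
    gcongr
  · have h (a : ℝ) : Real.exp (R * |a|) ≤ Real.exp (a * R) + Real.exp (a * -R) := by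
      rcases abs_choice a with h | h <;> rw [h]
      · rw [mul_comm R a]
        linarith [Real.exp_pos (a * -R)]
      · rw [show R * -a = a * -R by ring]
        linarith [Real.exp_pos (a * R)]
    rw [mul_add, Real.exp_add]
    refine (mul_le_mul (h _) (h _) (Real.exp_pos _).le (by positivity)).trans_eq ?_
    simp only [Real.exp_add]
    ring

lemma tsum_jacobiTerm_S (f : HermitianModularForm (-4) k) (m : ℕ) (τ : ℍ) (x y : ℂ) :
    ∑' q, f.jacobiTerm m (ModularGroup.S • τ) ((τ : ℂ)⁻¹ * x) ((τ : ℂ)⁻¹ * y) q =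
      (τ : ℂ) ^ k * (cexp (m * (2 * π * Complex.I * τ)⁻¹ * (x ^ 2 + y ^ 2)) *
        ∑' q, f.jacobiTerm m τ x y q) := by
  have hpi := two_pi_I_ne_zero
  have hτ : (τ : ℂ) ≠ 0 := τ.ne_zero
  have hS : ((ModularGroup.S • τ : ℍ) : ℂ) = (-(τ : ℂ))⁻¹ := by rw [modular_S_smul]
  set u := (2 * π * Complex.I)⁻¹ * x with hu
  set v := (2 * π * Complex.I)⁻¹ * y with hv
  have hu' : (2 * π * Complex.I)⁻¹ * ((τ : ℂ)⁻¹ * x) = (τ : ℂ)⁻¹ * u := by rw [hu]; ring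
  have hv' : (2 * π * Complex.I)⁻¹ * ((τ : ℂ)⁻¹ * y) = (τ : ℂ)⁻¹ * v := by rw [hv]; ring
  set κ := (u ^ 2 + v ^ 2) * (τ : ℂ)⁻¹ with hκ
  obtain ⟨T, hT⟩ := exists_mem_tube τ u v
  obtain ⟨T', hT'⟩ := exists_mem_tube (ModularGroup.S • τ) ((τ : ℂ)⁻¹ * u) ((τ : ℂ)⁻¹ * v)
  rw [hS] at hT'
  set t : ℂ := (max T (T' + κ.im) + 1 : ℝ) * Complex.I with ht
  have htim : t.im = max T (T' + κ.im) + 1 := by simp [ht]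
  have hmem (a : ℝ) : (t + a, (τ : ℂ), u, v) ∈ tube := hT _ (by
    rw [add_im, ofReal_im, htim]
    linarith [le_max_left T (T' + κ.im)])
  have hmem' (a : ℝ) : (t + a - κ, (-(τ : ℂ))⁻¹, (τ : ℂ)⁻¹ * u, (τ : ℂ)⁻¹ * v) ∈ tube := hT' _ (by
    rw [sub_im, add_im, ofReal_im, htim]
    linarith [le_max_right T (T' + κ.im)])
  have hshift (p : ℤ × ℤ × ℤ × ℤ) (s : ℂ) (w : ℂ × ℂ × ℂ) (a : ℝ) :
      hermExp p (s, w) * circleChar p.1 a = hermExp p (s + a, w) := by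
    simp only [hermExp, circleChar, ← Complex.exp_add]
    ring_nf
  have key := tsum_eq_of_circleChar
    (d := fun p => f.fourier p * hermExp p (t - κ, (-(τ : ℂ))⁻¹, (τ : ℂ)⁻¹ * u, (τ : ℂ)⁻¹ * v))
    (d' := fun p => (τ : ℂ) ^ k * (f.fourier p * hermExp p (t, (τ : ℂ), u, v)))
    (by simpa using (f.hasSum_fourier (hmem' 0)).summable)
    (by simpa using (f.hasSum_fourier (hmem 0)).summable.mul_left _) (fun a => by
      simp only [mul_assoc, hshift, tsum_mul_left, sub_add_eq_add_sub]
      rw [(f.hasSum_fourier (hmem a)).tsum_eq, (f.hasSum_fourier (hmem' a)).tsum_eq,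
        f.toFun_inversion (hmem a)]) m
  rw [← hS, ← hu', ← hv', hu, hv] at key
  simp only [fourier_mul_hermExp, tsum_mul_left] at key
  have hexp : cexp (2 * π * Complex.I * (m * t)) =
      cexp (2 * π * Complex.I * (m * (t - κ))) *
        cexp (m * (2 * π * Complex.I * τ)⁻¹ * (x ^ 2 + y ^ 2)) := by
    rw [← Complex.exp_add]
    congr 1
    rw [hκ, hu, hv]
    field_simp
    ring
  rw [hexp] at key
  refine mul_left_cancel₀ (Complex.exp_ne_zero (2 * π * Complex.I * (m * (t - κ)))) (key.trans ?_)
  ring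

lemma isJacobiCoeff_jacobi (f : HermitianModularForm (-4) k) (hk : Even k)
    (hf : IsSymmetricHMF f) (m : ℕ) : IsJacobiCoeff k m (f.jacobi m) where
  nonneg p hp := (f.fourier_ne_zero hp).2.1
  sq_add_sq_le p hp := (f.fourier_ne_zero hp).2.2
  even_left n r s := f.jacobi_neg_left hk hf m n r s
  even_right n r s := f.jacobi_neg_right hf m n r s
  elliptic_left n r s := f.fourier_shear_left hk m n r s
  elliptic_right n r s := f.fourier_shear_right hk m n r s
  rapid q hq R := f.rapid_jacobi m hq R
  transform τ x y := by
    rw [f.fourierJacobi_jacobi hk hf, f.fourierJacobi_jacobi hk hf]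
    exact f.tsum_jacobiTerm_S m τ x y

end HermitianModularForm

end FourierJacobiExpansion

section Integrality

/-- The ring of `p`-integral rational numbers. -/
def pIntegral (p : ℕ) (hp : p.Prime) : Subring ℂ where
  carrier := {z | IsPIntegral p z}
  zero_mem' := ⟨0, 1, (Nat.prime_iff_prime_int.1 hp).not_dvd_one, by simp⟩
  one_mem' := ⟨1, 1, (Nat.prime_iff_prime_int.1 hp).not_dvd_one, by simp⟩
  neg_mem' := by
    rintro z ⟨a, b, hb, h⟩
    exact ⟨-a, b, hb, by push_cast; rw [← h]; ring⟩
  add_mem' := by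
    rintro z w ⟨a, b, hb, h⟩ ⟨c, d, hd, h'⟩
    refine ⟨a * d + c * b, b * d, (Nat.prime_iff_prime_int.1 hp).not_dvd_mul hb hd, ?_⟩
    push_cast
    rw [← h, ← h']
    ring
  mul_mem' := by
    rintro z w ⟨a, b, hb, h⟩ ⟨c, d, hd, h'⟩
    refine ⟨a * c, b * d, (Nat.prime_iff_prime_int.1 hp).not_dvd_mul hb hd, ?_⟩
    push_cast
    rw [← h, ← h']
    ring

lemma inv_twelve_mem_pIntegral {p : ℕ} (hp : p.Prime) (hp5 : 5 ≤ p) :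
    (12 : ℂ)⁻¹ ∈ pIntegral p hp := by
  refine ⟨1, 12, fun h => ?_, by norm_num⟩
  have h12 : p ∣ 2 * 2 * 3 := by exact_mod_cast h
  rcases hp.dvd_mul.1 h12 with h | h
  · have := Nat.le_of_dvd two_pos ((hp.dvd_mul.1 h).elim id id)
    omega
  · have := Nat.le_of_dvd three_pos h
    omega

end Integrality

/-- **p-integrality criterion over ℚ(√-1)** (Corollary 1.2 (1), `K = ℚ(√-1)`).
If a symmetric Hermitian modular form of even weight `k` with rational Fourier
coefficients has `a_f([[m, α], [ᾱ, n]]) ∈ ℤ_(p)` for all `0 ≤ m ≤ (5k+8)/40`,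
`0 ≤ n ≤ (15k+4)/120`, `α ∈ D_K⁻¹` with `mn - N(α) ≥ 0`, then all its Fourier
coefficients are `p`-integral. -/
theorem integrality_criterion_sqrt_neg_one
    (p : ℕ) (hp : Nat.Prime p) (hp5 : 5 ≤ p) (k : ℤ) (hk : Even k)
    (f : HermitianModularForm (-4) k) (hsym : IsSymmetricHMF f)
    (hrat : ∀ H, ∃ q : ℚ, f.coeff H = (q : ℂ))
    (hint : ∀ (m n : ℤ) (α : ℂ), α ∈ invDiff (-4) →
      0 ≤ m → 40 * m ≤ 5 * k + 8 → 0 ≤ n → 120 * n ≤ 15 * k + 4 →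
      Complex.normSq α ≤ (m : ℝ) * (n : ℝ) →
      IsPIntegral p (f.coeff !![(m : ℂ), α; (starRingEnd ℂ) α, (n : ℂ)])) :
    ∀ H, IsPIntegral p (f.coeff H) := by
  set A := pIntegral p hp
  have hA : (12 : ℂ)⁻¹ ∈ A := inv_twelve_mem_pIntegral hp hp5
  have hsmall (m n r s : ℤ) (hm : 8 * m ≤ k) (hn : 8 * n ≤ k) : f.fourier (m, n, r, s) ∈ A := by
    by_cases h0 : f.fourier (m, n, r, s) = 0
    · rw [h0]
      exact A.zero_mem
    obtain ⟨h1, h2, h3⟩ := f.fourier_ne_zero h0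
    refine hint m n _ (mem_invDiff_neg_four.2 ⟨r, s, rfl⟩) h1 (by linarith) h2 (by linarith) ?_
    have h4 : ((r : ℝ) ^ 2 + (s : ℝ) ^ 2) ≤ 4 * m * n := by exact_mod_cast h3
    simp [normSq_apply]
    linarith
  have key (m : ℕ) : ∀ q, f.jacobi m q ∈ A := by
    induction m using Nat.strong_induction_on with
    | _ m ih =>
    refine (f.isJacobiCoeff_jacobi hk hsym m).mem_of_sturm hA fun n r s hn => ?_
    by_cases h0 : f.jacobi m (n, r, s) = 0
    · rw [h0]
      exact A.zero_mem
    rcases lt_or_ge n m with hlt | hge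
    · lift n to ℕ using (f.fourier_ne_zero h0).2.1
      have := ih n (by exact_mod_cast hlt) (m, r, -s)
      rwa [HermitianModularForm.jacobi, f.fourier_swap hk] at this
    · exact hsmall m n r s (by linarith) (by linarith)
  intro H
  by_cases h0 : f.coeff H = 0
  · rw [h0]
    exact A.zero_mem
  obtain ⟨q, rfl⟩ := exists_hermIndex_eq (f.coeff_supported H h0).1
  have hq := (f.fourier_ne_zero h0).1
  have := key q.1.toNat q.2
  rwa [HermitianModularForm.jacobi, Int.toNat_of_nonneg hq] at this

end
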